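/- For every real $\epsilon$ with $0 < \epsilon < 1/2$ there exists a constant $C = C(\epsilon) > 0$ such that for every prime $p$ with $p \equiv 1 \pmod{12}$ or $p \equiv 11 \pmod{12}$ one has $Q(p, S_3) - \frac{p-1}{6} \ge C\, p^{\frac{1}{2} - \epsilon}$ (as real numbers). -/

import Mathlib

/-- `a` is a quadratic residue modulo `p`: the congruence `x^2 ≡ a (mod p)` has a solution in `ℤ`. -/
def IsQR (p a : ℕ) : Prop := ∃ x : ℤ, x ^ 2 ≡ (a : ℤ) [ZMOD (p : ℤ)]

open Classical in
/-- `Q(p, S_k)`: the number of quadratic residues modulo `p` in `[1, p-1]` that are multiples of `k`. -/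
noncomputable def Qcount (p k : ℕ) : ℕ :=
  ((Finset.Icc 1 (p - 1)).filter fun a => k ∣ a ∧ IsQR p a).card

open Classical in
/-- `N(p, S_k)`: the number of quadratic non-residues modulo `p` in `[1, p-1]` that are multiples of `k`. -/
noncomputable def Ncount (p k : ℕ) : ℕ :=
  ((Finset.Icc 1 (p - 1)).filter fun a => k ∣ a ∧ ¬ IsQR p a).card

open Classical in
/-- `Q(p, 𝒪)`: the number of quadratic residues modulo `p` among the odd integers in `[1, p-1]`. -/
noncomputable def QcountOdd (p : ℕ) : ℕ :=
  ((Finset.Icc 1 (p - 1)).filter fun a => Odd a ∧ IsQR p a).card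

open Classical in
/-- `Q(p, S_2 \ S_4)`: the number of quadratic residues modulo `p` in `[1, p-1]`
divisible by `2` but not by `4`. -/
noncomputable def Qcount2not4 (p : ℕ) : ℕ :=
  ((Finset.Icc 1 (p - 1)).filter fun a => (2 ∣ a ∧ ¬ (4 ∣ a)) ∧ IsQR p a).card

namespace DirichletCharacter

variable {N : ℕ}

/-- The sum of the values of a Dirichlet character over `0, …, n - 1`. -/
noncomputable def partialSum (χ : DirichletCharacter ℂ N) (n : ℕ) : ℂ :=
  ∑ k ∈ Finset.range n, χ k

lemma norm_partialSum_le (χ : DirichletCharacter ℂ N) (n : ℕ) : ‖χ.partialSum n‖ ≤ n := by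
  simpa [partialSum] using norm_sum_le_of_le (Finset.range n) fun (k : ℕ) _ ↦ χ.norm_le_one k

lemma partialSum_add_level [NeZero N] {χ : DirichletCharacter ℂ N} (hχ : χ ≠ 1) (n : ℕ) :
    χ.partialSum (n + N) = χ.partialSum n := by
  have h0 : χ.partialSum N = 0 := by
    rw [partialSum, Finset.sum_range, ← MulChar.sum_eq_zero_of_ne_one hχ]
    refine Fintype.sum_equiv (ZMod.finEquiv N).toEquiv _ _ fun i ↦ ?_
    congr 1
    obtain ⟨m, rfl⟩ := Nat.exists_eq_succ_of_ne_zero (NeZero.ne N)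
    exact Fin.cast_val_eq_self i
  rw [add_comm, partialSum, Finset.sum_range_add]
  simp only [Nat.cast_add, CharP.cast_eq_zero, zero_add]
  rw [← partialSum, ← partialSum, h0, zero_add]

lemma norm_partialSum_le_level [NeZero N] {χ : DirichletCharacter ℂ N} (hχ : χ ≠ 1) (n : ℕ) :
    ‖χ.partialSum n‖ ≤ N := by
  have : χ.partialSum n = χ.partialSum (n % N) :=
    ((show Function.Periodic χ.partialSum N from partialSum_add_level hχ).map_mod_nat n).symm
  rw [this]
  refine (norm_partialSum_le χ _).trans ?_
  exact_mod_cast (Nat.mod_lt n (NeZero.pos N)).le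

/-- The terms of the series for `L(s, χ)` obtained by summation by parts. -/
noncomputable def abelTerm (χ : DirichletCharacter ℂ N) (s : ℂ) (m : ℕ) : ℂ :=
  χ.partialSum (m + 2) * (((m + 1 : ℕ) : ℂ) ^ (-s) - ((m + 2 : ℕ) : ℂ) ^ (-s))

lemma _root_.Complex.norm_natCast_cpow_neg_sub_le {s : ℂ} (hs : 0 < s.re) (m : ℕ) :
    ‖((m + 1 : ℕ) : ℂ) ^ (-s) - ((m + 2 : ℕ) : ℂ) ^ (-s)‖ ≤
      ‖s‖ * ((m + 1 : ℕ) : ℝ) ^ (-(s.re + 1)) := by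
  have hs0 : -s ≠ 0 := by
    intro h
    rw [neg_eq_zero] at h
    simp [h] at hs
  have key := Convex.norm_image_sub_le_of_norm_hasDerivWithin_le
    (f := fun x : ℝ ↦ (x : ℂ) ^ (-s)) (f' := fun x : ℝ ↦ -s * (x : ℂ) ^ (-s - 1))
    (s := Set.Icc ((m + 1 : ℕ) : ℝ) ((m + 2 : ℕ) : ℝ)) (x := ((m + 2 : ℕ) : ℝ))
    (y := ((m + 1 : ℕ) : ℝ)) (C := ‖s‖ * ((m + 1 : ℕ) : ℝ) ^ (-(s.re + 1))) ?_ ?_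
    (convex_Icc _ _) ?_ ?_
  · refine (by simpa using key : _ ≤ _).trans (le_of_eq ?_)
    push_cast
    norm_num
  · intro x hx
    have hx0 : 0 < x := lt_of_lt_of_le (by positivity) hx.1
    exact (hasDerivAt_ofReal_cpow_const hx0.ne' (r := -s) hs0).hasDerivWithinAt
  · intro x hx
    have hx0 : 0 < x := lt_of_lt_of_le (by positivity) hx.1
    rw [norm_mul, norm_neg, Complex.norm_cpow_eq_rpow_re_of_pos hx0]
    refine mul_le_mul_of_nonneg_left ?_ (norm_nonneg _)
    have : (-s - 1).re = -(s.re + 1) := by simp; ring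
    rw [this]
    exact Real.rpow_le_rpow_of_nonpos (by positivity) hx.1 (by linarith)
  · simp
  · simp

lemma norm_abelTerm_le [NeZero N] {χ : DirichletCharacter ℂ N} (hχ : χ ≠ 1) {s : ℂ}
    (hs : 0 < s.re) (m : ℕ) :
    ‖χ.abelTerm s m‖ ≤ N * (‖s‖ * ((m + 1 : ℕ) : ℝ) ^ (-(s.re + 1))) := by
  rw [abelTerm, norm_mul]
  exact mul_le_mul (norm_partialSum_le_level hχ _) (Complex.norm_natCast_cpow_neg_sub_le hs m)
    (norm_nonneg _) (by positivity)

lemma summable_natCast_succ_rpow {a : ℝ} (ha : 0 < a) :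
    Summable fun m : ℕ ↦ ((m + 1 : ℕ) : ℝ) ^ (-(a + 1)) :=
  (summable_nat_add_iff 1).mpr (Real.summable_nat_rpow.mpr (by linarith))

lemma differentiableOn_tsum_abelTerm [NeZero N] {χ : DirichletCharacter ℂ N} (hχ : χ ≠ 1) :
    DifferentiableOn ℂ (fun s ↦ ∑' m, χ.abelTerm s m) {s | 0 < s.re} := by
  intro s hs
  have hs : 0 < s.re := hs
  set U : Set ℂ := {z | s.re / 2 < z.re} ∩ Metric.ball 0 (‖s‖ + 1) with hU
  have hUo : IsOpen U :=
    (isOpen_lt continuous_const Complex.continuous_re).inter Metric.isOpen_ball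
  have hsU : s ∈ U := ⟨by simp; linarith, by simp⟩
  have : DifferentiableOn ℂ (fun s ↦ ∑' m, χ.abelTerm s m) U := by
    refine Complex.differentiableOn_tsum_of_summable_norm
      (u := fun m : ℕ ↦ N * ((‖s‖ + 1) * ((m + 1 : ℕ) : ℝ) ^ (-(s.re / 2 + 1))))
      (((summable_natCast_succ_rpow (by linarith)).mul_left _).mul_left _) ?_ hUo ?_
    · intro m
      refine Differentiable.differentiableOn ?_
      unfold abelTerm
      refine (differentiable_const _).mul (Differentiable.sub ?_ ?_) <;>
      · refine Differentiable.const_cpow (by fun_prop) (Or.inl ?_)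
        exact Nat.cast_ne_zero.mpr (Nat.succ_ne_zero _)
    · intro m w hw
      have hw1 : s.re / 2 < w.re := hw.1
      have hw2 : ‖w‖ < ‖s‖ + 1 := by simpa using hw.2
      refine (norm_abelTerm_le hχ (by linarith) m).trans ?_
      gcongr
      exact_mod_cast Nat.le_add_left 1 m
  exact (this.differentiableAt (hUo.mem_nhds hsU)).differentiableWithinAt

lemma LFunction_eq_tsum_abelTerm_of_one_lt_re [NeZero N] {χ : DirichletCharacter ℂ N}
    (hχ : χ ≠ 1) {s : ℂ} (hs : 1 < s.re) : LFunction χ s = ∑' m, χ.abelTerm s m := by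
  have hs0 : s ≠ 0 := by
    rintro rfl
    norm_num at hs
  have hN : N ≠ 1 := by
    rintro rfl
    exact hχ (level_one χ)
  have hχ0 : χ (0 : ZMod N) = 0 := χ.map_zero' hN
  have hsum (c : ℕ → ℂ) (hc : ∀ n, ‖c n‖ ≤ N) :
      Summable fun m : ℕ ↦ c m * ((m + 1 : ℕ) : ℂ) ^ (-s) := by
    refine Summable.of_norm_bounded
      (g := fun m : ℕ ↦ N * ((m + 1 : ℕ) : ℝ) ^ (-((s.re - 1) + 1)))
      ((summable_natCast_succ_rpow (by linarith)).mul_left _) fun m ↦ ?_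
    rw [norm_mul, Complex.norm_natCast_cpow_of_pos (Nat.succ_pos m)]
    refine mul_le_mul (hc m) (le_of_eq ?_) (by positivity) (by positivity)
    simp
  have h1 := hsum (fun m ↦ χ.partialSum (m + 2)) fun _ ↦ norm_partialSum_le_level hχ _
  have h2 := hsum (fun m ↦ χ.partialSum (m + 1)) fun _ ↦ norm_partialSum_le_level hχ _
  have h2' := (summable_nat_add_iff 1).mpr h2
  rw [LFunction_eq_LSeries χ hs, LSeries, (ZMod.LSeriesSummable_of_one_lt_re χ hs).tsum_eq_zero_add]
  have hterm (m : ℕ) : LSeries.term (fun n : ℕ ↦ χ n) s (m + 1) =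
      χ.partialSum (m + 2) * ((m + 1 : ℕ) : ℂ) ^ (-s) -
        χ.partialSum (m + 1) * ((m + 1 : ℕ) : ℂ) ^ (-s) := by
    rw [LSeries.term_of_ne_zero (Nat.succ_ne_zero m), ← sub_mul, partialSum, partialSum,
      Finset.sum_range_succ _ (m + 1), add_sub_cancel_left, Complex.cpow_neg, div_eq_mul_inv]
  simp_rw [hterm]
  rw [h1.tsum_sub h2, h2.tsum_eq_zero_add, LSeries.term_zero]
  have h3 : χ.partialSum (0 + 1) = 0 := by simp [partialSum, hχ0]
  rw [h3, zero_mul, zero_add, zero_add]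
  rw [← h1.tsum_sub h2']
  refine tsum_congr fun m ↦ ?_
  rw [abelTerm, mul_sub]

lemma LFunction_eq_tsum_abelTerm [NeZero N] {χ : DirichletCharacter ℂ N}
    (hχ : χ ≠ 1) {s : ℂ} (hs : 0 < s.re) : LFunction χ s = ∑' m, χ.abelTerm s m := by
  have ho : IsOpen {s : ℂ | 0 < s.re} := isOpen_lt continuous_const Complex.continuous_re
  refine AnalyticOnNhd.eqOn_of_preconnected_of_eventuallyEq
    ((differentiable_LFunction hχ).differentiableOn.analyticOnNhd ho)
    ((differentiableOn_tsum_abelTerm hχ).analyticOnNhd ho)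
    (convex_halfSpace_re_gt 0).isPreconnected (z₀ := 2) (by simp) ?_ hs
  filter_upwards [(isOpen_lt continuous_const Complex.continuous_re).mem_nhds
    (show (1 : ℝ) < (2 : ℂ).re by simp)] with z hz
  exact LFunction_eq_tsum_abelTerm_of_one_lt_re hχ hz

lemma summable_abelTerm [NeZero N] {χ : DirichletCharacter ℂ N}
    (hχ : χ ≠ 1) {s : ℂ} (hs : 0 < s.re) : Summable (χ.abelTerm s) :=
  Summable.of_norm_bounded (((summable_natCast_succ_rpow hs).mul_left _).mul_left _)
    (norm_abelTerm_le hχ hs)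

/-- A linear bound in the level for `L(s, χ)`, uniform for `s` in a right half-plane. -/
lemma exists_norm_LFunction_le {a : ℝ} (ha : 0 < a) : ∃ K : ℝ, 0 < K ∧
    ∀ (N : ℕ) [NeZero N] (χ : DirichletCharacter ℂ N), χ ≠ 1 → ∀ s : ℂ, a ≤ s.re →
      ‖LFunction χ s‖ ≤ K * N * ‖s‖ := by
  have hsum := summable_natCast_succ_rpow ha
  refine ⟨∑' m : ℕ, ((m + 1 : ℕ) : ℝ) ^ (-(a + 1)),
    hsum.tsum_pos (fun _ ↦ by positivity) 0 (by positivity), fun N _ χ hχ s hs ↦ ?_⟩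
  rw [LFunction_eq_tsum_abelTerm hχ (by linarith), mul_assoc, ← tsum_mul_right]
  refine tsum_of_norm_bounded (hsum.mul_right _).hasSum fun m ↦ ?_
  refine (norm_abelTerm_le hχ (by linarith) m).trans ?_
  rw [mul_comm (_ ^ _), ← mul_assoc]
  gcongr
  exact_mod_cast Nat.le_add_left 1 m

/-- The value `L(1, χ)` is bounded by any positive power of the level. -/
lemma exists_norm_LFunction_one_le {ε : ℝ} (hε : 0 < ε) : ∃ K : ℝ, 0 < K ∧
    ∀ (N : ℕ) [NeZero N] (χ : DirichletCharacter ℂ N), χ ≠ 1 →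
      ‖LFunction χ 1‖ ≤ K * (N : ℝ) ^ ε := by
  wlog hε1 : ε < 1 generalizing ε
  · obtain ⟨K, hK, h⟩ := this (ε := 1 / 2) (by norm_num) (by norm_num)
    refine ⟨K, hK, fun N _ χ hχ ↦ (h N χ hχ).trans ?_⟩
    gcongr
    · exact_mod_cast NeZero.one_le
    · linarith
  have hsum := summable_natCast_succ_rpow hε
  refine ⟨∑' m : ℕ, 2 * ((m + 1 : ℕ) : ℝ) ^ (-(ε + 1)),
    (hsum.mul_left 2).tsum_pos (fun _ ↦ by positivity) 0 (by positivity), fun N _ χ hχ ↦ ?_⟩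
  rw [LFunction_eq_tsum_abelTerm hχ (by simp), ← tsum_mul_right]
  refine tsum_of_norm_bounded ((hsum.mul_left 2).mul_right _).hasSum fun m ↦ ?_
  have h1 : ‖χ.partialSum (m + 2)‖ ≤ (N : ℝ) ^ ε * (2 * ((m + 1 : ℕ) : ℝ) ^ (1 - ε)) := by
    have hx := norm_nonneg (χ.partialSum (m + 2))
    calc ‖χ.partialSum (m + 2)‖
        = ‖χ.partialSum (m + 2)‖ ^ ε * ‖χ.partialSum (m + 2)‖ ^ (1 - ε) := by
          rw [← Real.rpow_add' hx (by norm_num)]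
          simp
      _ ≤ (N : ℝ) ^ ε * (2 * ((m + 1 : ℕ) : ℝ)) ^ (1 - ε) := by
          refine mul_le_mul (Real.rpow_le_rpow hx (norm_partialSum_le_level hχ _) hε.le)
            (Real.rpow_le_rpow hx ((norm_partialSum_le χ _).trans ?_) (by linarith))
            (by positivity) (by positivity)
          push_cast
          have : (0 : ℝ) ≤ m := Nat.cast_nonneg m
          linarith
      _ ≤ (N : ℝ) ^ ε * (2 * ((m + 1 : ℕ) : ℝ) ^ (1 - ε)) := by
          rw [Real.mul_rpow (by norm_num) (by positivity)]
          gcongr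
          calc (2 : ℝ) ^ (1 - ε) ≤ 2 ^ (1 : ℝ) := by
                gcongr
                · norm_num
                · linarith
            _ = 2 := by norm_num
  have h2 := Complex.norm_natCast_cpow_neg_sub_le (s := 1) (by simp) m
  rw [abelTerm, norm_mul]
  refine (mul_le_mul h1 h2 (norm_nonneg _) (by positivity)).trans (le_of_eq ?_)
  have h3 : ((m + 1 : ℕ) : ℝ) ^ (-(ε + 1)) =
      ((m + 1 : ℕ) : ℝ) ^ (1 - ε) * ((m + 1 : ℕ) : ℝ) ^ (-((1 : ℂ).re + 1)) := by
    rw [← Real.rpow_add (by positivity)]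
    congr 1
    simp
    ring
  rw [h3]
  simp
  ring

/-- On the positive real axis the L-function of a quadratic character is real. -/
lemma LFunction_ofReal_im [NeZero N] {χ : DirichletCharacter ℂ N} (hχ : χ ≠ 1)
    (hq : χ.IsQuadratic) {x : ℝ} (hx : 0 < x) : (LFunction χ x).im = 0 := by
  have hre (a : ZMod N) : ∃ r : ℝ, χ a = r := by
    rcases hq a with h | h | h
    · exact ⟨0, by simp [h]⟩
    · exact ⟨1, by simp [h]⟩
    · exact ⟨-1, by simp [h]⟩
  choose r hr using hre
  have hterm (m : ℕ) : χ.abelTerm x m = ((∑ k ∈ Finset.range (m + 2), r k) *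
      (((m + 1 : ℕ) : ℝ) ^ (-x) - ((m + 2 : ℕ) : ℝ) ^ (-x)) : ℝ) := by
    rw [abelTerm, partialSum]
    simp only [Complex.ofReal_mul, Complex.ofReal_sub, Complex.ofReal_sum,
      Complex.ofReal_cpow (Nat.cast_nonneg _), Complex.ofReal_natCast, Complex.ofReal_neg, hr]
  rw [LFunction_eq_tsum_abelTerm hχ (by simpa using hx)]
  simp_rw [hterm]
  rw [← Complex.ofReal_tsum, Complex.ofReal_im]

end DirichletCharacter

open ComplexOrder in
/-- If `f' = -D f` near `x`, the derivatives of `D` at `x` alternate in sign, and `f x` is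
nonnegative, then the derivatives of `f` at `x` alternate in sign. -/
lemma iteratedDeriv_alternating_of_deriv_eq {f D : ℂ → ℂ} {x : ℂ} (hf : AnalyticAt ℂ f x)
    (hD : AnalyticAt ℂ D x) (hfD : deriv f =ᶠ[nhds x] fun s ↦ -(f s * D s))
    (hD0 : ∀ n, 0 ≤ (-1) ^ n * iteratedDeriv n D x) (hfx : 0 ≤ f x) (n : ℕ) :
    0 ≤ (-1) ^ n * iteratedDeriv n f x := by
  induction n using Nat.strong_induction_on with
  | _ n ih =>
    rcases n with - | n
    · simpa using hfx
    rw [iteratedDeriv_succ', hfD.iteratedDeriv_eq n, iteratedDeriv_fun_neg,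
      iteratedDeriv_fun_mul hf.contDiffAt hD.contDiffAt, pow_succ, mul_neg_one, neg_mul_neg,
      Finset.mul_sum]
    refine Finset.sum_nonneg fun i hi ↦ ?_
    have hi' : i ≤ n := Nat.lt_succ_iff.mp (Finset.mem_range.mp hi)
    have hpow : (-1 : ℂ) ^ n = (-1) ^ i * (-1) ^ (n - i) := by
      rw [← pow_add, Nat.add_sub_cancel' hi']
    have : (-1 : ℂ) ^ n * (n.choose i * iteratedDeriv i f x * iteratedDeriv (n - i) D x) =
        n.choose i * (((-1) ^ i * iteratedDeriv i f x) *
          ((-1) ^ (n - i) * iteratedDeriv (n - i) D x)) := by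
      rw [hpow]
      ring
    rw [this]
    exact mul_nonneg (by exact_mod_cast Nat.zero_le _)
      (mul_nonneg (ih i (Nat.lt_succ_of_le hi')) (hD0 _))

lemma iteratedDeriv_inv_sub_one (n : ℕ) :
    iteratedDeriv n (fun s : ℂ ↦ (s - 1)⁻¹) 2 = (-1) ^ n * n.factorial := by
  have := congr_fun (iter_deriv_inv_linear n (1 : ℂ) (-1)) 2
  rw [iteratedDeriv_eq_iterate]
  simp only [one_mul, ← sub_eq_add_neg, one_pow, mul_one] at this
  rw [this]
  norm_num

open ComplexOrder in
/-- Estermann's inequality: a lower bound for `f` to the left of its simple pole at `1`, when the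
derivatives of `f` at `2` alternate in sign. -/
lemma estermann_lower_bound {f F : ℂ → ℂ} {r M c β : ℝ} (hF : Differentiable ℂ F)
    (hfF : ∀ s ≠ 1, f s = F s + r * (s - 1)⁻¹)
    (halt : ∀ n, 0 ≤ (-1) ^ n * iteratedDeriv n f 2)
    (hM : ∀ s ∈ Metric.sphere (2 : ℂ) (3 / 2), ‖F s‖ ≤ M) (hc : c ≤ (f 2).re)
    (hβ : 7 / 8 ≤ β) (hβ1 : β < 1) {m : ℕ} (hm : m ≠ 0) :
    c - r * (2 - β) ^ m / (1 - β) - 4 * M * (3 / 4) ^ m ≤ (f β).re := by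
  have hM0 : 0 ≤ M := (norm_nonneg _).trans (hM ((2 : ℂ) + (3 / 2 : ℝ)) (by simp))
  set e : ℕ → ℝ := fun n ↦ ((n.factorial : ℂ)⁻¹ * ((-1) ^ n * iteratedDeriv n F 2)).re with he
  set y : ℝ := 2 - β with hy
  have hy1 : 1 < y := by linarith
  have hy2 : y ≤ 9 / 8 := by linarith
  have hs : HasSum (fun n ↦ e n * y ^ n) (F β).re := by
    have h := Complex.hasSum_re (Complex.hasSum_taylorSeries_on_ball (c := 2) (r := 3 / 2)
      hF.differentiableOn (z := (β : ℂ)) (by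
        rw [Metric.mem_ball, dist_eq_norm, show (β : ℂ) - 2 = ((β - 2 : ℝ) : ℂ) by push_cast; rfl,
          Complex.norm_real, Real.norm_eq_abs, abs_lt]
        constructor <;> linarith))
    refine h.congr_fun fun n ↦ ?_
    simp only [smul_eq_mul, he]
    rw [show (β : ℂ) - 2 = -(y : ℂ) by rw [hy]; push_cast; ring, neg_pow,
      ← Complex.re_mul_ofReal]
    congr 1
    push_cast
    ring
  have hder (n : ℕ) : iteratedDeriv n f 2 = iteratedDeriv n F 2 + r * ((-1) ^ n * n.factorial) := by
    have h1 : f =ᶠ[nhds 2] fun s ↦ F s + r * (s - 1)⁻¹ := by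
      filter_upwards [isOpen_ne.mem_nhds (show (2 : ℂ) ≠ 1 by norm_num)] with s hs
      exact hfF s hs
    have h2 : AnalyticAt ℂ (fun s : ℂ ↦ r * (s - 1)⁻¹) 2 :=
      analyticAt_const.fun_mul ((analyticAt_id.sub analyticAt_const).inv (by norm_num))
    rw [h1.iteratedDeriv_eq n, iteratedDeriv_fun_add (hF.analyticAt 2).contDiffAt
      h2.contDiffAt, iteratedDeriv_const_mul_field,
      iteratedDeriv_inv_sub_one]
  have hsign (n : ℕ) : ((-1 : ℂ) ^ n) * (-1) ^ n = 1 := by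
    rw [← mul_pow]
    norm_num
  have hb (n : ℕ) : -r ≤ e n := by
    have h1 : 0 ≤ (n.factorial : ℂ)⁻¹ * ((-1) ^ n * iteratedDeriv n f 2) :=
      mul_nonneg (by rw [inv_nonneg]; exact_mod_cast Nat.zero_le _) (halt n)
    have h2 : (n.factorial : ℂ)⁻¹ * ((-1) ^ n * iteratedDeriv n f 2) =
        (n.factorial : ℂ)⁻¹ * ((-1) ^ n * iteratedDeriv n F 2) + r := by
      have : (n.factorial : ℂ) ≠ 0 := by exact_mod_cast n.factorial_ne_zero
      rw [hder, mul_add, mul_add]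
      congr 1
      field_simp
      rw [pow_two, hsign, one_mul]
    rw [h2] at h1
    have := (Complex.le_def.mp h1).1
    simp only [Complex.zero_re, Complex.add_re, Complex.ofReal_re] at this
    linarith
  have h0 : c - r ≤ e 0 := by
    have h1 := hfF 2 (by norm_num)
    have h2 : e 0 = (F 2).re := by simp [he]
    rw [h1] at hc
    rw [h2]
    norm_num at hc
    linarith
  have htail (n : ℕ) : -(M * (3 / 4) ^ n) ≤ e n * y ^ n := by
    have h1 : |e n| ≤ M / (3 / 2) ^ n := by
      refine (Complex.abs_re_le_norm _).trans ?_
      have := Complex.norm_iteratedDeriv_le_of_forall_mem_sphere_norm_le n (by norm_num)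
        hF.diffContOnCl hM
      rw [norm_mul, norm_mul, norm_pow, norm_neg, norm_one, one_pow, one_mul, norm_inv,
        Complex.norm_natCast, inv_mul_le_iff₀ (by positivity)]
      rwa [mul_div_assoc] at this
    have h2 : |e n * y ^ n| ≤ M * (3 / 4) ^ n := by
      rw [abs_mul, abs_of_pos (by positivity : 0 < y ^ n)]
      calc |e n| * y ^ n ≤ M / (3 / 2) ^ n * (9 / 8) ^ n := by gcongr
        _ = M * (3 / 4) ^ n := by
          rw [div_mul_eq_mul_div, mul_div_assoc, ← div_pow]
          norm_num
    exact neg_le_of_abs_le h2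
  have hhead : c - r * ((y ^ m - 1) / (y - 1)) ≤ ∑ n ∈ Finset.range m, e n * y ^ n := by
    obtain ⟨k, rfl⟩ := Nat.exists_eq_succ_of_ne_zero hm
    rw [← geom_sum_eq hy1.ne', Finset.sum_range_succ', Finset.sum_range_succ' _ k, mul_add,
      Finset.mul_sum]
    have : -∑ i ∈ Finset.range k, r * y ^ (i + 1) ≤
        ∑ i ∈ Finset.range k, e (i + 1) * y ^ (i + 1) := by
      rw [← Finset.sum_neg_distrib]
      refine Finset.sum_le_sum fun i _ ↦ ?_
      have := mul_le_mul_of_nonneg_right (hb (i + 1)) (by positivity : 0 ≤ y ^ (i + 1))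
      linarith
    simp only [pow_zero, mul_one]
    linarith
  have htsum : -(4 * M * (3 / 4) ^ m) ≤ ∑' n, e (n + m) * y ^ (n + m) := by
    have hg : HasSum (fun n : ℕ ↦ -(M * (3 / 4) ^ m * (3 / 4 : ℝ) ^ n))
        (-(M * (3 / 4) ^ m * (1 - 3 / 4)⁻¹)) :=
      ((hasSum_geometric_of_lt_one (by norm_num) (by norm_num)).mul_left _).neg
    have := hasSum_le (fun n ↦ ?_) hg ((summable_nat_add_iff m).mpr hs.summable).hasSum
    · refine le_trans (le_of_eq ?_) this
      norm_num
      ring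
    · refine le_trans (le_of_eq ?_) (htail (n + m))
      rw [pow_add]
      ring
  have hsplit := hs.summable.sum_add_tsum_nat_add m
  rw [hs.tsum_eq] at hsplit
  have hfβ : (f β).re = (F β).re - r / (1 - β) := by
    rw [hfF β (by exact_mod_cast hβ1.ne), show (r : ℂ) * ((β : ℂ) - 1)⁻¹ =
      ((r * (β - 1)⁻¹ : ℝ) : ℂ) by push_cast; rfl, Complex.add_re, Complex.ofReal_re,
      show β - 1 = -(1 - β) by ring, inv_neg, div_eq_mul_inv]
    ring
  rw [hfβ, ← hsplit]
  have hy' : y - 1 = 1 - β := by rw [hy]; ring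
  rw [hy', sub_div, mul_sub, ← mul_div_assoc, ← mul_div_assoc, mul_one] at hhead
  linarith

namespace DirichletCharacter

open ArithmeticFunction (vonMangoldt vonMangoldt_nonneg)

variable {N₁ N₂ N₃ : ℕ} [NeZero N₁] [NeZero N₂] [NeZero N₃]
  {χ₁ : DirichletCharacter ℂ N₁} {χ₂ : DirichletCharacter ℂ N₂} {χ₃ : DirichletCharacter ℂ N₃}

/-- The product of the Riemann zeta function and three Dirichlet L-functions. -/
noncomputable def zetaProd (χ₁ : DirichletCharacter ℂ N₁) (χ₂ : DirichletCharacter ℂ N₂)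
    (χ₃ : DirichletCharacter ℂ N₃) (s : ℂ) : ℂ :=
  riemannZeta s * (LFunction χ₁ s * LFunction χ₂ s * LFunction χ₃ s)

lemma hasDerivAt_LFunction {N : ℕ} [NeZero N] (χ : DirichletCharacter ℂ N) {s : ℂ}
    (hs : 1 < s.re) :
    HasDerivAt (LFunction χ)
      (-(LFunction χ s * LSeries ((fun n : ℕ ↦ χ n) * fun n : ℕ ↦ (vonMangoldt n : ℂ)) s)) s := by
  have hs1 : s ≠ 1 := by
    rintro rfl
    simp at hs
  have hne := LFunction_ne_zero_of_one_le_re χ (.inr hs1) hs.le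
  have h := (differentiableAt_LFunction χ s (.inl hs1)).hasDerivAt
  rw [LSeries_twist_vonMangoldt_eq χ hs, ← deriv_LFunction_eq_deriv_LSeries χ hs,
    ← LFunction_eq_LSeries χ hs]
  convert! h using 1
  field_simp

/-- The coefficients of minus the logarithmic derivative of `zetaProd χ₁ χ₂ χ₃`. -/
noncomputable def zetaProdCoeff (χ₁ : DirichletCharacter ℂ N₁) (χ₂ : DirichletCharacter ℂ N₂)
    (χ₃ : DirichletCharacter ℂ N₃) : ℕ → ℂ :=
  (fun n : ℕ ↦ (1 : DirichletCharacter ℂ 1) n) * (fun n : ℕ ↦ (vonMangoldt n : ℂ)) +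
    ((fun n : ℕ ↦ χ₁ n) * (fun n : ℕ ↦ (vonMangoldt n : ℂ)) +
      (fun n : ℕ ↦ χ₂ n) * (fun n : ℕ ↦ (vonMangoldt n : ℂ)) +
        (fun n : ℕ ↦ χ₃ n) * (fun n : ℕ ↦ (vonMangoldt n : ℂ)))

open ComplexOrder in
omit [NeZero N₁] [NeZero N₂] [NeZero N₃] in
lemma zetaProdCoeff_nonneg (h₁ : χ₁.IsQuadratic) (h₂ : χ₂.IsQuadratic)
    (h₃ : ∀ n : ℕ, χ₃ n = χ₁ n * χ₂ n) : 0 ≤ zetaProdCoeff χ₁ χ₂ χ₃ := by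
  intro n
  have h1 : (1 : DirichletCharacter ℂ 1) n = 1 := MulChar.one_apply (isUnit_of_subsingleton _)
  have hq {N : ℕ} {χ : DirichletCharacter ℂ N} (h : χ.IsQuadratic) : 0 ≤ 1 + χ n := by
    rcases h n with h | h | h <;> rw [h] <;> norm_num
  have : zetaProdCoeff χ₁ χ₂ χ₃ n = (1 + χ₁ n) * (1 + χ₂ n) * vonMangoldt n := by
    simp only [zetaProdCoeff, Pi.add_apply, Pi.mul_apply, h1, h₃]
    ring
  rw [this]
  exact mul_nonneg (mul_nonneg (hq h₁) (hq h₂))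
    (Complex.zero_le_real.mpr vonMangoldt_nonneg)

lemma hasDerivAt_zetaProd (χ₁ : DirichletCharacter ℂ N₁) (χ₂ : DirichletCharacter ℂ N₂)
    (χ₃ : DirichletCharacter ℂ N₃) {s : ℂ} (hs : 1 < s.re) :
    HasDerivAt (zetaProd χ₁ χ₂ χ₃)
      (-(zetaProd χ₁ χ₂ χ₃ s * LSeries (zetaProdCoeff χ₁ χ₂ χ₃) s)) s := by
  have h0 := hasDerivAt_LFunction (1 : DirichletCharacter ℂ 1) hs
  rw [LFunction_modOne_eq] at h0
  have h1 := h0.mul (((hasDerivAt_LFunction χ₁ hs).mul (hasDerivAt_LFunction χ₂ hs)).mul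
    (hasDerivAt_LFunction χ₃ hs))
  have hs0 := LSeriesSummable_twist_vonMangoldt (1 : DirichletCharacter ℂ 1) hs
  have hs1 := LSeriesSummable_twist_vonMangoldt χ₁ hs
  have hs2 := LSeriesSummable_twist_vonMangoldt χ₂ hs
  have hs3 := LSeriesSummable_twist_vonMangoldt χ₃ hs
  convert! h1 using 1
  rw [zetaProdCoeff, LSeries_add hs0 ((hs1.add hs2).add hs3), LSeries_add (hs1.add hs2) hs3,
    LSeries_add hs1 hs2, zetaProd]
  simp only [Pi.mul_apply]
  ring

omit [NeZero N₁] [NeZero N₂] [NeZero N₃] in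
lemma abscissaOfAbsConv_zetaProdCoeff_le :
    LSeries.abscissaOfAbsConv (zetaProdCoeff χ₁ χ₂ χ₃) ≤ 1 := by
  refine LSeries.abscissaOfAbsConv_le_of_forall_lt_LSeriesSummable fun y hy ↦ ?_
  have hy : 1 < (y : ℂ).re := by simpa using hy
  exact (LSeriesSummable_twist_vonMangoldt _ hy).add
    (((LSeriesSummable_twist_vonMangoldt _ hy).add
      (LSeriesSummable_twist_vonMangoldt _ hy)).add (LSeriesSummable_twist_vonMangoldt _ hy))

/-- A uniform positive lower bound for `L(2, χ)`. -/
lemma le_re_LFunction_two {N : ℕ} [NeZero N] (χ : DirichletCharacter ℂ N) :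
    2 - Real.pi ^ 2 / 6 ≤ (LFunction χ 2).re := by
  have hz := hasSum_zeta_two
  have hz1 : HasSum (fun n : ℕ ↦ 1 / ((n + 2 : ℕ) : ℝ) ^ 2) (Real.pi ^ 2 / 6 - 1) := by
    have := (hasSum_nat_add_iff' 2).mpr hz
    simpa [Finset.sum_range_succ] using this
  have hs : LSeriesSummable (fun n : ℕ ↦ χ n) 2 :=
    ZMod.LSeriesSummable_of_one_lt_re χ (by simp)
  rw [LFunction_eq_LSeries χ (by simp), LSeries, ← hs.sum_add_tsum_nat_add 2]
  have h1 : ‖∑' n, LSeries.term (fun n : ℕ ↦ χ n) 2 (n + 2)‖ ≤ Real.pi ^ 2 / 6 - 1 := by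
    refine tsum_of_norm_bounded hz1 fun n ↦ ?_
    rw [LSeries.term_of_ne_zero (by omega), norm_div, Complex.norm_natCast_cpow_of_pos (by omega)]
    simp only [Complex.re_ofNat, Real.rpow_ofNat]
    gcongr
    exact χ.norm_le_one _
  have h2 := neg_le_of_abs_le ((Complex.abs_re_le_norm _).trans h1)
  simp only [Finset.sum_range_succ, Finset.range_zero, Finset.sum_empty, zero_add,
    LSeries.term_zero, Complex.add_re]
  rw [LSeries.term_of_ne_zero one_ne_zero]
  simp only [Nat.cast_one, map_one, Complex.one_cpow, div_one, Complex.one_re]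
  linarith

lemma two_sub_pi_sq_div_six_pos : 0 < 2 - Real.pi ^ 2 / 6 := by
  have := Real.pi_lt_d2
  have := Real.pi_pos
  nlinarith

lemma LFunction_two_eq_ofReal {N : ℕ} [NeZero N] {χ : DirichletCharacter ℂ N} (hχ : χ ≠ 1)
    (hq : χ.IsQuadratic) : LFunction χ 2 = ((LFunction χ 2).re : ℂ) := by
  have := LFunction_ofReal_im hχ hq (x := 2) (by norm_num)
  exact Complex.ext rfl (by simpa using this)

lemma exists_zetaProd_two (hχ₁ : χ₁ ≠ 1) (hχ₂ : χ₂ ≠ 1) (hχ₃ : χ₃ ≠ 1) (h₁ : χ₁.IsQuadratic)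
    (h₂ : χ₂.IsQuadratic) (h₃ : χ₃.IsQuadratic) :
    ∃ r : ℝ, zetaProd χ₁ χ₂ χ₃ 2 = r ∧ (2 - Real.pi ^ 2 / 6) ^ 3 ≤ r := by
  refine ⟨Real.pi ^ 2 / 6 * ((LFunction χ₁ 2).re * (LFunction χ₂ 2).re * (LFunction χ₃ 2).re),
    ?_, ?_⟩
  · rw [zetaProd, riemannZeta_two, LFunction_two_eq_ofReal hχ₁ h₁, LFunction_two_eq_ofReal hχ₂ h₂,
      LFunction_two_eq_ofReal hχ₃ h₃]
    push_cast
    simp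
  · have h0 := two_sub_pi_sq_div_six_pos
    have hpi : 1 ≤ Real.pi ^ 2 / 6 := by
      have := Real.pi_gt_three
      nlinarith
    have h : (2 - Real.pi ^ 2 / 6) ^ 3 ≤
        (LFunction χ₁ 2).re * (LFunction χ₂ 2).re * (LFunction χ₃ 2).re := by
      rw [pow_three']
      have h1 := le_re_LFunction_two χ₁
      have h2 := le_re_LFunction_two χ₂
      have h3 := le_re_LFunction_two χ₃
      gcongr
      · exact mul_nonneg (h0.le.trans h1) (h0.le.trans h2)
      · exact h0.le.trans h1
    exact h.trans (le_mul_of_one_le_left ((by positivity : (0 : ℝ) ≤ _).trans h) hpi)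

open ComplexOrder in
lemma iteratedDeriv_zetaProd_alternating (hχ₁ : χ₁ ≠ 1) (hχ₂ : χ₂ ≠ 1) (hχ₃ : χ₃ ≠ 1)
    (h₁ : χ₁.IsQuadratic) (h₂ : χ₂.IsQuadratic) (h₃ : χ₃.IsQuadratic)
    (h : ∀ n : ℕ, χ₃ n = χ₁ n * χ₂ n) (n : ℕ) :
    0 ≤ (-1) ^ n * iteratedDeriv n (zetaProd χ₁ χ₂ χ₃) 2 := by
  have hU : {s : ℂ | 1 < s.re} ∈ nhds (2 : ℂ) :=
    (isOpen_lt continuous_const Complex.continuous_re).mem_nhds (by simp)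
  have habs : LSeries.abscissaOfAbsConv (zetaProdCoeff χ₁ χ₂ χ₃) < ((2 : ℝ) : EReal) :=
    abscissaOfAbsConv_zetaProdCoeff_le.trans_lt (by exact_mod_cast one_lt_two)
  refine iteratedDeriv_alternating_of_deriv_eq (D := LSeries (zetaProdCoeff χ₁ χ₂ χ₃))
    ?_ ?_ ?_ ?_ ?_ n
  · exact DifferentiableOn.analyticAt (s := {s : ℂ | 1 < s.re}) (fun s hs ↦
      (hasDerivAt_zetaProd χ₁ χ₂ χ₃ hs).differentiableAt.differentiableWithinAt) hU
  · exact LSeries_analyticOnNhd _ 2 (by simpa using habs)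
  · filter_upwards [hU] with s hs using (hasDerivAt_zetaProd χ₁ χ₂ χ₃ hs).deriv
  · intro n
    simpa using LSeries.iteratedDeriv_alternating (zetaProdCoeff_nonneg h₁ h₂ h) habs n
  · obtain ⟨r, hr, hr'⟩ := exists_zetaProd_two hχ₁ hχ₂ hχ₃ h₁ h₂ h₃
    rw [hr]
    have := two_sub_pi_sq_div_six_pos
    exact Complex.zero_le_real.mpr ((by positivity : (0 : ℝ) ≤ _).trans hr')

end DirichletCharacter

namespace DirichletCharacter

variable {N₁ N₂ N₃ : ℕ} [NeZero N₁] [NeZero N₂] [NeZero N₃]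
  {χ₁ : DirichletCharacter ℂ N₁} {χ₂ : DirichletCharacter ℂ N₂} {χ₃ : DirichletCharacter ℂ N₃}

/-- The entire function obtained from `zetaProd` by removing its simple pole at `1`. -/
noncomputable def zetaProdEntire (χ₁ : DirichletCharacter ℂ N₁) (χ₂ : DirichletCharacter ℂ N₂)
    (χ₃ : DirichletCharacter ℂ N₃) : ℂ → ℂ :=
  dslope (fun s ↦ LFunctionTrivChar₁ 1 s * (LFunction χ₁ s * LFunction χ₂ s * LFunction χ₃ s)) 1

lemma differentiable_zetaProdEntire (hχ₁ : χ₁ ≠ 1) (hχ₂ : χ₂ ≠ 1) (hχ₃ : χ₃ ≠ 1) :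
    Differentiable ℂ (zetaProdEntire χ₁ χ₂ χ₃) := by
  rw [← differentiableOn_univ, zetaProdEntire,
    Complex.differentiableOn_dslope Filter.univ_mem, differentiableOn_univ]
  exact (differentiable_LFunctionTrivChar₁ 1).fun_mul
    (((differentiable_LFunction hχ₁).fun_mul (differentiable_LFunction hχ₂)).fun_mul
      (differentiable_LFunction hχ₃))

lemma LFunctionTrivChar₁_one_one : LFunctionTrivChar₁ 1 1 = 1 := by
  simp [LFunctionTrivChar₁]

lemma LFunctionTrivChar₁_one_apply {s : ℂ} (hs : s ≠ 1) :
    LFunctionTrivChar₁ 1 s = (s - 1) * riemannZeta s := by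
  simp [LFunctionTrivChar₁, hs, LFunctionTrivChar, LFunction_modOne_eq]

lemma zetaProdEntire_apply {s : ℂ} (hs : s ≠ 1) :
    zetaProdEntire χ₁ χ₂ χ₃ s =
      (s - 1)⁻¹ * (LFunctionTrivChar₁ 1 s * (LFunction χ₁ s * LFunction χ₂ s * LFunction χ₃ s) -
        LFunction χ₁ 1 * LFunction χ₂ 1 * LFunction χ₃ 1) := by
  rw [zetaProdEntire, dslope_of_ne _ hs, slope_def_field, LFunctionTrivChar₁_one_one, one_mul,
    div_eq_inv_mul]

lemma zetaProd_eq_zetaProdEntire_add {s : ℂ} (hs : s ≠ 1) :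
    zetaProd χ₁ χ₂ χ₃ s = zetaProdEntire χ₁ χ₂ χ₃ s +
      LFunction χ₁ 1 * LFunction χ₂ 1 * LFunction χ₃ 1 * (s - 1)⁻¹ := by
  rw [zetaProdEntire_apply hs, LFunctionTrivChar₁_one_apply hs, zetaProd]
  field_simp [sub_ne_zero.mpr hs]
  ring

lemma exists_norm_zetaProdEntire_le :
    ∃ K > 0, ∀ (N₁ N₂ : ℕ) [NeZero N₁] [NeZero N₂] (χ₁ : DirichletCharacter ℂ N₁)
      (χ₂ : DirichletCharacter ℂ N₂) (χ₃ : DirichletCharacter ℂ (N₁ * N₂)),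
      χ₁ ≠ 1 → χ₂ ≠ 1 → χ₃ ≠ 1 → ∀ s ∈ Metric.sphere (2 : ℂ) (3 / 2),
      ‖zetaProdEntire χ₁ χ₂ χ₃ s‖ ≤ K * ((N₁ * N₂ : ℕ) : ℝ) ^ 2 := by
  obtain ⟨K, hK, hL⟩ := exists_norm_LFunction_le (a := 1 / 2) (by norm_num)
  obtain ⟨B, hB⟩ := (isCompact_sphere (2 : ℂ) (3 / 2)).exists_bound_of_continuousOn
    (differentiable_LFunctionTrivChar₁ 1).continuous.continuousOn
  have hB0 : 0 ≤ B := (norm_nonneg _).trans (hB ((2 : ℂ) + (3 / 2 : ℝ)) (by simp))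
  refine ⟨2 * (B * (K * 4) ^ 3 + (K * 4) ^ 3), by positivity, ?_⟩
  intro N₁ N₂ _ _ χ₁ χ₂ χ₃ h₁ h₂ h₃ s hs
  have key (z : ℂ) (hz : 1 / 2 ≤ z.re) (hz' : ‖z‖ ≤ 4) :
      ‖LFunction χ₁ z * LFunction χ₂ z * LFunction χ₃ z‖ ≤
        (K * 4) ^ 3 * ((N₁ * N₂ : ℕ) : ℝ) ^ 2 := by
    have e {N : ℕ} [NeZero N] (χ : DirichletCharacter ℂ N) (h : χ ≠ 1) :
        ‖LFunction χ z‖ ≤ K * N * 4 := (hL N χ h z hz).trans (by gcongr)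
    rw [norm_mul, norm_mul]
    calc _ ≤ (K * N₁ * 4) * (K * N₂ * 4) * (K * (N₁ * N₂ : ℕ) * 4) := by
          gcongr
          exacts [e χ₁ h₁, e χ₂ h₂, e χ₃ h₃]
      _ = _ := by
          push_cast
          ring
  rw [mem_sphere_iff_norm] at hs
  have hre := (abs_le.mp ((Complex.abs_re_le_norm (s - 2)).trans_eq hs)).1
  have hs4 : ‖s‖ ≤ 4 := by
    calc ‖s‖ = ‖(s - 2) + 2‖ := by ring_nf
      _ ≤ ‖s - 2‖ + ‖(2 : ℂ)‖ := norm_add_le _ _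
      _ ≤ 4 := by rw [hs]; norm_num
  have hs1 : 1 / 2 ≤ ‖s - 1‖ := by
    have := norm_sub_le (s - 1) 1
    rw [show s - 1 - 1 = s - 2 by ring, hs, norm_one] at this
    linarith
  have hsne : s ≠ 1 := by
    rintro rfl
    norm_num at hs1
  simp only [Complex.sub_re, Complex.re_ofNat] at hre
  rw [zetaProdEntire_apply hsne, norm_mul, norm_inv]
  calc _ ≤ 2 * (B * ((K * 4) ^ 3 * ((N₁ * N₂ : ℕ) : ℝ) ^ 2) +
        (K * 4) ^ 3 * ((N₁ * N₂ : ℕ) : ℝ) ^ 2) := by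
        gcongr
        · exact inv_le_of_inv_le₀ (by norm_num) (by linarith)
        · refine (norm_sub_le _ _).trans ?_
          rw [norm_mul]
          gcongr
          · exact hB s (by simpa [mem_sphere_iff_norm] using hs)
          · exact key s (by linarith) hs4
          · exact key 1 (by norm_num) (by norm_num)
    _ = _ := by ring

/-- Estermann's inequality for the product of three values at `1`. -/
lemma exists_le_mul_LFunction_one :
    ∃ k > 0, ∃ K ≥ 1, ∀ (N₁ N₂ : ℕ) [NeZero N₁] [NeZero N₂] (χ₁ : DirichletCharacter ℂ N₁)
      (χ₂ : DirichletCharacter ℂ N₂) (χ₃ : DirichletCharacter ℂ (N₁ * N₂)),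
      χ₁ ≠ 1 → χ₂ ≠ 1 → χ₃ ≠ 1 → χ₁.IsQuadratic → χ₂.IsQuadratic → χ₃.IsQuadratic →
      (∀ n : ℕ, χ₃ n = χ₁ n * χ₂ n) → ∀ β : ℝ, 7 / 8 ≤ β → β < 1 →
      (zetaProd χ₁ χ₂ χ₃ β).re ≤ 0 →
      k * (1 - β) * (K * ((N₁ * N₂ : ℕ) : ℝ) ^ 2) ^ (-(4 * (1 - β))) ≤
        (LFunction χ₁ 1).re * (LFunction χ₂ 1).re * (LFunction χ₃ 1).re := by
  obtain ⟨K, hK, hF⟩ := exists_norm_zetaProdEntire_le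
  set c : ℝ := (2 - Real.pi ^ 2 / 6) ^ 3 with hc
  have hc0 : 0 < c := pow_pos two_sub_pi_sq_div_six_pos 3
  refine ⟨c / 2 * Real.exp (-2), by positivity, max 1 (8 * K / c), le_max_left _ _, ?_⟩
  intro N₁ N₂ _ _ χ₁ χ₂ χ₃ h₁ h₂ h₃ q₁ q₂ q₃ h β hβ hβ1 hneg
  have hreal {N : ℕ} [NeZero N] {χ : DirichletCharacter ℂ N} (hχ : χ ≠ 1)
      (hq : χ.IsQuadratic) : LFunction χ 1 = ((LFunction χ 1).re : ℂ) := by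
    have := LFunction_ofReal_im hχ hq (x := 1) (by norm_num)
    exact Complex.ext rfl (by simpa using this)
  set l := (LFunction χ₁ 1).re * (LFunction χ₂ 1).re * (LFunction χ₃ 1).re with hl
  set M := max 1 (8 * K / c) * ((N₁ * N₂ : ℕ) : ℝ) ^ 2 with hM
  have hN : (1 : ℝ) ≤ (N₁ * N₂ : ℕ) := by
    exact_mod_cast Nat.one_le_iff_ne_zero.mpr (NeZero.ne _)
  have hM1 : 1 ≤ M := one_le_mul_of_one_le_of_one_le (le_max_left _ _) (one_le_pow₀ hN)
  have hlog : 0 ≤ Real.log M := Real.log_nonneg hM1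
  set m := ⌈4 * Real.log M⌉₊ + 1 with hm
  have hm1 : 4 * Real.log M ≤ m := by
    rw [hm]
    push_cast
    linarith [Nat.le_ceil (4 * Real.log M)]
  have hm2 : (m : ℝ) ≤ 4 * Real.log M + 2 := by
    rw [hm]
    push_cast
    linarith [(Nat.ceil_lt_add_one (show 0 ≤ 4 * Real.log M by positivity))]
  have hE := estermann_lower_bound (f := zetaProd χ₁ χ₂ χ₃) (F := zetaProdEntire χ₁ χ₂ χ₃)
    (r := l) (M := K * ((N₁ * N₂ : ℕ) : ℝ) ^ 2) (c := c) (β := β)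
    (differentiable_zetaProdEntire h₁ h₂ h₃) (fun s hs ↦ by
      rw [zetaProd_eq_zetaProdEntire_add hs, hreal h₁ q₁, hreal h₂ q₂, hreal h₃ q₃, hl]
      push_cast
      rfl)
    (iteratedDeriv_zetaProd_alternating h₁ h₂ h₃ q₁ q₂ q₃ h)
    (hF N₁ N₂ χ₁ χ₂ χ₃ h₁ h₂ h₃) (by
      obtain ⟨r, hr, hr'⟩ := exists_zetaProd_two h₁ h₂ h₃ q₁ q₂ q₃
      rwa [hr]) hβ hβ1 (m := m) (by simp [hm])
  have h34 : (3 / 4 : ℝ) ^ m ≤ M⁻¹ := by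
    have : Real.log (3 / 4) ≤ -(1 / 4) := by
      linarith [Real.log_le_sub_one_of_pos (show (0 : ℝ) < 3 / 4 by norm_num)]
    rw [← Real.exp_log (show (0 : ℝ) < 3 / 4 by norm_num), ← Real.exp_nat_mul,
      ← Real.exp_log (show 0 < M by linarith), ← Real.exp_neg, Real.exp_le_exp]
    nlinarith
  have hrem : 4 * (K * ((N₁ * N₂ : ℕ) : ℝ) ^ 2) * (3 / 4) ^ m ≤ c / 2 := by
    calc _ ≤ 4 * (K * ((N₁ * N₂ : ℕ) : ℝ) ^ 2) * M⁻¹ := by gcongr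
      _ ≤ c / 2 := by
        rw [← div_eq_mul_inv, div_le_iff₀ (by linarith)]
        calc _ = c / 2 * (8 * K / c * ((N₁ * N₂ : ℕ) : ℝ) ^ 2) := by
              field_simp
              ring
          _ ≤ _ := by
              rw [hM]
              gcongr
              exact le_max_right _ _
  have hβ' : 0 < 1 - β := by linarith
  have h2 : c / 2 * (1 - β) ≤ l * (2 - β) ^ m := by
    rw [← le_div_iff₀ hβ']
    linarith
  have hpow : (2 - β) ^ m ≤ Real.exp 2 * M ^ (4 * (1 - β)) := by
    calc (2 - β) ^ m ≤ Real.exp (1 - β) ^ m := by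
          gcongr
          · linarith
          · linarith [Real.add_one_le_exp (1 - β)]
      _ = Real.exp (m * (1 - β)) := by rw [← Real.exp_nat_mul]
      _ ≤ Real.exp (2 + Real.log M * (4 * (1 - β))) := by
          rw [Real.exp_le_exp]
          nlinarith
      _ = _ := by rw [Real.exp_add, Real.rpow_def_of_pos (by linarith)]
  have hl0 : 0 ≤ l := by
    have : 0 < (2 - β) ^ m := pow_pos (by linarith) _
    have h0 : 0 ≤ l * (2 - β) ^ m := h2.trans' (by positivity)
    exact nonneg_of_mul_nonneg_left h0 this
  have hMp : 0 < M ^ (4 * (1 - β)) := Real.rpow_pos_of_pos (by linarith) _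
  rw [Real.rpow_neg (by linarith), Real.exp_neg, ← div_eq_mul_inv, div_le_iff₀ hMp]
  have h3 := h2.trans (mul_le_mul_of_nonneg_left hpow hl0)
  rw [show c / 2 * (Real.exp 2)⁻¹ * (1 - β) = c / 2 * (1 - β) / Real.exp 2 by
    rw [div_eq_mul_inv (c / 2 * (1 - β))]; ring, div_le_iff₀ (Real.exp_pos 2)]
  linarith

end DirichletCharacter

namespace DirichletCharacter

/-- A quadratic L-function with no zeros on `[a, 1)` is positive at `a`. -/
lemma re_LFunction_pos {N : ℕ} [NeZero N] {χ : DirichletCharacter ℂ N} (hχ : χ ≠ 1)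
    (hq : χ.IsQuadratic) {a : ℝ} (ha : 0 < a) (ha2 : a ≤ 2)
    (h : ∀ x : ℝ, a ≤ x → x < 1 → LFunction χ x ≠ 0) : 0 < (LFunction χ a).re := by
  by_contra! hneg
  have hcont : Continuous fun x : ℝ ↦ (LFunction χ x).re :=
    Complex.continuous_re.comp ((differentiable_LFunction hχ).continuous.comp
      Complex.continuous_ofReal)
  have h2 : 0 ≤ (LFunction χ (2 : ℝ)).re :=
    two_sub_pi_sq_div_six_pos.le.trans (by simpa using le_re_LFunction_two χ)
  obtain ⟨x, hx, hx0⟩ := intermediate_value_Icc ha2 hcont.continuousOn ⟨hneg, h2⟩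
  have hz : LFunction χ x = 0 :=
    Complex.ext hx0 (LFunction_ofReal_im hχ hq (ha.trans_le hx.1))
  rcases lt_or_ge x 1 with h1 | h1
  · exact h x hx.1 h1 hz
  · exact LFunction_ne_zero_of_one_le_re χ (.inl hχ) (by simpa using h1) hz

lemma re_LFunction_one_pos {N : ℕ} [NeZero N] {χ : DirichletCharacter ℂ N} (hχ : χ ≠ 1)
    (hq : χ.IsQuadratic) : 0 < (LFunction χ 1).re := by
  have := re_LFunction_pos hχ hq one_pos one_le_two
    (fun x hx hx' ↦ absurd hx hx'.not_ge)
  simpa using this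

lemma exists_re_riemannZeta_neg :
    ∃ b < (1 : ℝ), ∀ x : ℝ, b < x → x < 1 → (riemannZeta x).re ≤ 0 := by
  have h := riemannZeta_residue_one
  have h1 : Filter.Tendsto (fun x : ℝ ↦ (((x : ℂ) - 1) * riemannZeta x).re)
      (nhdsWithin 1 (Set.Iio 1)) (nhds 1) := by
    have : Filter.Tendsto (fun x : ℝ ↦ (x : ℂ)) (nhdsWithin 1 (Set.Iio 1))
        (nhdsWithin 1 {1}ᶜ) := by
      refine tendsto_nhdsWithin_iff.mpr ⟨?_, ?_⟩
      · exact (by simpa using Complex.continuous_ofReal.tendsto 1 :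
          Filter.Tendsto (fun x : ℝ ↦ (x : ℂ)) (nhds 1) (nhds 1)).mono_left nhdsWithin_le_nhds
      · filter_upwards [self_mem_nhdsWithin] with x hx
        simpa using ne_of_lt hx
    exact (Complex.continuous_re.tendsto 1).comp (h.comp this)
  obtain ⟨b, hb, hb'⟩ := (mem_nhdsLT_iff_exists_Ioo_subset).mp
    (h1.eventually (lt_mem_nhds (show (0 : ℝ) < 1 by norm_num)))
  refine ⟨b, hb, fun x hx hx1 ↦ ?_⟩
  have := hb' ⟨hx, hx1⟩
  simp only [Set.mem_ofPred_eq] at this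
  rw [show (x : ℂ) - 1 = ((x - 1 : ℝ) : ℂ) by push_cast; rfl, Complex.re_ofReal_mul] at this
  nlinarith

/-- The product of two Dirichlet characters, at the product of the levels. -/
noncomputable def prodChar {N₁ N₂ : ℕ} (χ₁ : DirichletCharacter ℂ N₁)
    (χ₂ : DirichletCharacter ℂ N₂) : DirichletCharacter ℂ (N₁ * N₂) :=
  changeLevel (dvd_mul_right N₁ N₂) χ₁ * changeLevel (dvd_mul_left N₂ N₁) χ₂

lemma prodChar_apply {N₁ N₂ : ℕ} (χ₁ : DirichletCharacter ℂ N₁)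
    (χ₂ : DirichletCharacter ℂ N₂) (n : ℕ) : prodChar χ₁ χ₂ n = χ₁ n * χ₂ n := by
  by_cases h : IsUnit (n : ZMod (N₁ * N₂))
  · rw [prodChar, MulChar.mul_apply, ← h.unit_spec, changeLevel_eq_cast_of_dvd,
      changeLevel_eq_cast_of_dvd, h.unit_spec, ZMod.cast_natCast (dvd_mul_right _ _),
      ZMod.cast_natCast (dvd_mul_left _ _)]
  · rw [MulChar.map_nonunit _ h]
    rw [ZMod.isUnit_iff_coprime, Nat.coprime_mul_iff_right, not_and_or] at h
    rcases h with h | h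
    · rw [MulChar.map_nonunit χ₁ (by rwa [ZMod.isUnit_iff_coprime]), zero_mul]
    · rw [MulChar.map_nonunit χ₂ (by rwa [ZMod.isUnit_iff_coprime]), mul_zero]

lemma prodChar_isQuadratic {N₁ N₂ : ℕ} [NeZero N₁] [NeZero N₂] {χ₁ : DirichletCharacter ℂ N₁}
    {χ₂ : DirichletCharacter ℂ N₂} (h₁ : χ₁.IsQuadratic) (h₂ : χ₂.IsQuadratic) :
    (prodChar χ₁ χ₂).IsQuadratic := by
  intro a
  obtain ⟨n, rfl⟩ := ZMod.natCast_zmod_surjective a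
  rw [prodChar_apply]
  rcases h₁ n with h | h | h <;> rcases h₂ n with e | e | e <;> simp [h, e]

/-- A nontrivial quadratic character. -/
lemma exists_isQuadratic_ne_one :
    ∃ χ : DirichletCharacter ℂ 4, χ ≠ 1 ∧ χ.IsQuadratic := by
  refine ⟨ZMod.χ₄.ringHomComp (Int.castRingHom ℂ), ?_, ?_⟩
  · rw [MulChar.ne_one_iff]
    refine ⟨-1, ?_⟩
    have h : ZMod.χ₄ ((-1 : (ZMod 4)ˣ) : ZMod 4) = -1 := by decide
    rw [MulChar.ringHomComp_apply, h]
    norm_num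
  · exact ZMod.isQuadratic_χ₄.comp _

lemma exists_char_forall_exists_le :
    ∀ b < (1 : ℝ), ∃ (N₁ : ℕ) (_ : NeZero N₁) (χ₁ : DirichletCharacter ℂ N₁), χ₁ ≠ 1 ∧
      χ₁.IsQuadratic ∧ ∃ β : ℝ, b < β ∧ β < 1 ∧ ∀ (N₂ : ℕ) [NeZero N₂]
      (χ₂ : DirichletCharacter ℂ N₂), χ₂ ≠ 1 → χ₂.IsQuadratic → prodChar χ₁ χ₂ ≠ 1 →
      (zetaProd χ₁ χ₂ (prodChar χ₁ χ₂) β).re ≤ 0 := by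
  intro b hb
  obtain ⟨b', hb', hζ⟩ := exists_re_riemannZeta_neg
  set a := max (max b b') 0 with ha
  have ha1 : a < 1 := max_lt (max_lt hb hb') one_pos
  have hab : b ≤ a := (le_max_left _ _).trans (le_max_left _ _)
  have hab' : b' ≤ a := (le_max_right _ _).trans (le_max_left _ _)
  have ha0 : 0 ≤ a := le_max_right _ _
  by_cases hex : ∃ (N₁ : ℕ) (_ : NeZero N₁) (χ₁ : DirichletCharacter ℂ N₁), χ₁ ≠ 1 ∧
      χ₁.IsQuadratic ∧ ∃ β : ℝ, a < β ∧ β < 1 ∧ LFunction χ₁ β = 0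
  · obtain ⟨N₁, hN, χ₁, h₁, q₁, β, hβ, hβ1, h0⟩ := hex
    refine ⟨N₁, hN, χ₁, h₁, q₁, β, hab.trans_lt hβ, hβ1, fun N₂ _ χ₂ _ _ _ ↦ ?_⟩
    simp [zetaProd, h0]
  · push Not at hex
    obtain ⟨χ₁, h₁, q₁⟩ := exists_isQuadratic_ne_one
    refine ⟨4, inferInstance, χ₁, h₁, q₁, (a + 1) / 2, by linarith, by linarith, ?_⟩
    intro N₂ _ χ₂ h₂ q₂ h₃
    have q₃ := prodChar_isQuadratic q₁ q₂
    have hpos {N : ℕ} [NeZero N] {χ : DirichletCharacter ℂ N} (hχ : χ ≠ 1)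
        (hq : χ.IsQuadratic) : ∃ r : ℝ, LFunction χ ((a + 1) / 2 : ℝ) = r ∧ 0 < r :=
      ⟨_, Complex.ext rfl (LFunction_ofReal_im hχ hq (by linarith)),
        re_LFunction_pos hχ hq (by linarith) (by linarith)
          fun x hx hx1 ↦ hex N inferInstance χ hχ hq x (by linarith) hx1⟩
    obtain ⟨r₁, e₁, p₁⟩ := hpos h₁ q₁
    obtain ⟨r₂, e₂, p₂⟩ := hpos h₂ q₂
    obtain ⟨r₃, e₃, p₃⟩ := hpos h₃ q₃
    rw [zetaProd, e₁, e₂, e₃, ← Complex.ofReal_mul, ← Complex.ofReal_mul, Complex.re_mul_ofReal]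
    exact mul_nonpos_of_nonpos_of_nonneg (hζ _ (by linarith) (by linarith)) (by positivity)

/-- **Siegel's theorem**, with one possible exceptional character. -/
theorem exists_char_forall_le_LFunction_one {ε : ℝ} (hε : 0 < ε) :
    ∃ (N₁ : ℕ) (_ : NeZero N₁) (χ₁ : DirichletCharacter ℂ N₁), ∃ C > 0,
      ∀ (N₂ : ℕ) [NeZero N₂] (χ₂ : DirichletCharacter ℂ N₂), χ₂ ≠ 1 → χ₂.IsQuadratic →
      prodChar χ₁ χ₂ ≠ 1 → C * (N₂ : ℝ) ^ (-ε) ≤ (LFunction χ₂ 1).re := by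
  obtain ⟨k, hk, K, hK, hle⟩ := exists_le_mul_LFunction_one
  obtain ⟨K₃, hK₃, hup⟩ := exists_norm_LFunction_one_le (ε := ε / 2) (by positivity)
  obtain ⟨N₁, hN, χ₁, h₁, q₁, β, hβ, hβ1, hneg⟩ :=
    exists_char_forall_exists_le (max (7 / 8) (1 - ε / 16))
      (max_lt (by norm_num) (by linarith))
  have hβ7 : 7 / 8 ≤ β := (le_max_left _ _).trans hβ.le
  have hβε : 1 - ε / 16 ≤ β := (le_max_right _ _).trans hβ.le
  have hL₁ := re_LFunction_one_pos h₁ q₁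
  have hN₁ : (0 : ℝ) < N₁ := by exact_mod_cast Nat.pos_of_ne_zero (NeZero.ne N₁)
  have hβ' : 0 < 1 - β := by linarith
  set D := (LFunction χ₁ 1).re * (K₃ * (N₁ : ℝ) ^ (ε / 2)) with hD
  have hD0 : 0 < D := by positivity
  set A := k * (1 - β) * (K * (N₁ : ℝ) ^ 2) ^ (-(4 * (1 - β))) with hA
  have hA0 : 0 < A := by positivity
  refine ⟨N₁, hN, χ₁, A / D, div_pos hA0 hD0, fun N₂ _ χ₂ h₂ q₂ h₃ ↦ ?_⟩
  have hN₂ : (1 : ℝ) ≤ N₂ := by exact_mod_cast Nat.one_le_iff_ne_zero.mpr (NeZero.ne N₂)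
  have hN₂' : (0 : ℝ) < N₂ := by linarith
  have hL₂ := re_LFunction_one_pos h₂ q₂
  have h := hle N₁ N₂ χ₁ χ₂ _ h₁ h₂ h₃ q₁ q₂ (prodChar_isQuadratic q₁ q₂)
    (prodChar_apply χ₁ χ₂) β hβ7 hβ1 (hneg N₂ χ₂ h₂ q₂ h₃)
  have hlow : A * (N₂ : ℝ) ^ (-(ε / 2)) ≤
      k * (1 - β) * (K * ((N₁ * N₂ : ℕ) : ℝ) ^ 2) ^ (-(4 * (1 - β))) := by
    rw [show K * ((N₁ * N₂ : ℕ) : ℝ) ^ 2 = (K * (N₁ : ℝ) ^ 2) * (N₂ : ℝ) ^ (2 : ℝ) by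
      push_cast
      rw [Real.rpow_two]
      ring, Real.mul_rpow (by positivity) (by positivity), ← mul_assoc, ← hA,
      ← Real.rpow_mul hN₂'.le]
    gcongr
    linarith
  have hupp : (LFunction (prodChar χ₁ χ₂) 1).re ≤
      K₃ * (N₁ : ℝ) ^ (ε / 2) * (N₂ : ℝ) ^ (ε / 2) := by
    refine (Complex.re_le_norm _).trans ((hup _ _ h₃).trans_eq ?_)
    push_cast
    rw [Real.mul_rpow hN₁.le hN₂'.le, mul_assoc]
  have hfin : A * (N₂ : ℝ) ^ (-(ε / 2)) ≤ (LFunction χ₂ 1).re * (D * (N₂ : ℝ) ^ (ε / 2)) := by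
    refine hlow.trans (h.trans ?_)
    calc _ ≤ (LFunction χ₁ 1).re * (LFunction χ₂ 1).re *
          (K₃ * (N₁ : ℝ) ^ (ε / 2) * (N₂ : ℝ) ^ (ε / 2)) := by gcongr
      _ = _ := by rw [hD]; ring
  rw [div_mul_eq_mul_div, div_le_iff₀ hD0]
  have hx : 0 < (N₂ : ℝ) ^ (ε / 2) := by positivity
  have e1 : (N₂ : ℝ) ^ (-ε) * (N₂ : ℝ) ^ (ε / 2) = (N₂ : ℝ) ^ (-(ε / 2)) := by
    rw [← Real.rpow_add hN₂']
    ring_nf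
  refine le_of_mul_le_mul_right ?_ hx
  rw [mul_assoc, e1]
  linarith

end DirichletCharacter

namespace DirichletCharacter

variable {N : ℕ} [NeZero N] {χ : DirichletCharacter ℂ N}

lemma sum_range_div_eq (hχ : χ ≠ 1) (m : ℕ) :
    ∑ k ∈ Finset.range (m + 2), χ k / k =
      ∑ j ∈ Finset.range m, χ.abelTerm 1 j + χ.partialSum (m + 2) / (m + 1) := by
  induction m with
  | zero =>
    have hN : N ≠ 1 := by
      rintro rfl
      exact hχ (level_one χ)
    have h0 : χ 0 = 0 := by
      have : Fact (1 < N) := ⟨by have := NeZero.ne N; omega⟩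
      rw [MulChar.map_zero]
    simp [partialSum, Finset.sum_range_succ, h0]
  | succ m ih =>
    have h1 : (m + 1 : ℂ) ≠ 0 := by exact_mod_cast m.succ_ne_zero
    have h2 : (m + 2 : ℂ) ≠ 0 := by exact_mod_cast (m + 1).succ_ne_zero
    rw [Finset.sum_range_succ, ih, Finset.sum_range_succ _ m, abelTerm,
      show χ.partialSum (m + 1 + 2) = χ.partialSum (m + 2) + χ ((m + 2 : ℕ) : ZMod N) from
        Finset.sum_range_succ _ _, Complex.cpow_neg_one, Complex.cpow_neg_one]
    push_cast
    rw [show (m + 1 + 1 : ℂ) = m + 2 by ring]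
    field_simp
    ring

/-- The series `∑ χ(n) / n` converges to `L(1, χ)`. -/
lemma tendsto_sum_range_div (hχ : χ ≠ 1) :
    Filter.Tendsto (fun n : ℕ ↦ ∑ k ∈ Finset.range n, χ k / k) Filter.atTop
      (nhds (LFunction χ 1)) := by
  rw [← Filter.tendsto_add_atTop_iff_nat 2]
  simp_rw [sum_range_div_eq hχ]
  have h1 : Filter.Tendsto (fun m : ℕ ↦ ∑ j ∈ Finset.range m, χ.abelTerm 1 j) Filter.atTop
      (nhds (LFunction χ 1)) := by
    rw [LFunction_eq_tsum_abelTerm hχ (by simp)]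
    exact (summable_abelTerm hχ (by simp)).hasSum.tendsto_sum_nat
  have h2 : Filter.Tendsto (fun m : ℕ ↦ χ.partialSum (m + 2) / (m + 1)) Filter.atTop
      (nhds 0) := by
    refine squeeze_zero_norm (a := fun m : ℕ ↦ (N : ℝ) * (1 / ((m : ℝ) + 1))) (fun m ↦ ?_) ?_
    · rw [norm_div, show (m + 1 : ℂ) = ((m + 1 : ℕ) : ℂ) by push_cast; rfl, Complex.norm_natCast,
        div_eq_mul_one_div]
      push_cast
      gcongr
      exact norm_partialSum_le_level hχ _
    · simpa using tendsto_one_div_add_atTop_nhds_zero_nat.const_mul (N : ℝ)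
  simpa using h1.add h2

/-- If the values of `χ` are a combination of characters of `ℤ`, then `L(1, χ)` is the
corresponding combination of logarithms. -/
lemma LFunction_one_eq_sum_log (hχ : χ ≠ 1) {ι : Type*} (S : Finset ι) (c ω : ι → ℂ)
    (hω : ∀ j ∈ S, ‖ω j‖ = 1) (hω1 : ∀ j ∈ S, ω j ≠ 1)
    (h : ∀ n : ℕ, χ n = ∑ j ∈ S, c j * ω j ^ n) :
    LFunction χ 1 = ∑ j ∈ S, c j * -Complex.log (1 - ω j) := by
  have h1 := Complex.tendsto_tsum_powerSeries_nhdsWithin_lt (tendsto_sum_range_div hχ)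
  have h2 : Filter.Tendsto (fun z : ℂ ↦ ∑ j ∈ S, c j * -Complex.log (1 - z * ω j))
      ((nhdsWithin 1 (Set.Iio 1)).map Complex.ofReal)
      (nhds (∑ j ∈ S, c j * -Complex.log (1 - ω j))) := by
    have hle : (nhdsWithin (1 : ℝ) (Set.Iio 1)).map Complex.ofReal ≤ nhds (1 : ℂ) := by
      have := Complex.continuous_ofReal.tendsto 1
      rw [Complex.ofReal_one] at this
      exact (Filter.map_mono nhdsWithin_le_nhds).trans this
    refine Filter.Tendsto.mono_left ?_ hle
    refine tendsto_finsetSum _ fun j hj ↦ Filter.Tendsto.const_mul _ (Filter.Tendsto.neg ?_)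
    have hslit : 1 - ω j ∈ Complex.slitPlane := by
      left
      have h3 : (ω j).re ≤ 1 := (Complex.re_le_norm _).trans (hω j hj).le
      rcases h3.lt_or_eq with h3 | h3
      · simpa using h3
      · refine absurd ?_ (hω1 j hj)
        have h4 := Complex.sq_norm (ω j)
        rw [hω j hj, Complex.normSq_apply, h3] at h4
        exact Complex.ext (by simpa using h3) (by simpa using (by nlinarith : (ω j).im ^ 2 = 0))
    have hc : ContinuousAt (fun z : ℂ ↦ Complex.log (1 - z * ω j)) 1 :=
      ContinuousAt.clog (by fun_prop) (by simpa using hslit)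
    simpa using hc.tendsto
  refine tendsto_nhds_unique (h1.congr' ?_) h2
  rw [Filter.EventuallyEq, Filter.eventually_map]
  filter_upwards [Ioo_mem_nhdsLT (show (0 : ℝ) < 1 by norm_num)] with r hr
  have h3 (j : ι) (hj : j ∈ S) : HasSum (fun n : ℕ ↦ c j * ((r * ω j) ^ n / n))
      (c j * -Complex.log (1 - r * ω j)) := by
    refine (Complex.hasSum_taylorSeries_neg_log ?_).mul_left _
    rw [norm_mul, hω j hj, mul_one, Complex.norm_real, Real.norm_of_nonneg hr.1.le]
    exact hr.2
  rw [← (hasSum_sum h3).tsum_eq]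
  congr 1
  ext n
  rw [h, Finset.sum_div, Finset.sum_mul]
  refine Finset.sum_congr rfl fun j _ ↦ ?_
  rw [mul_pow]
  ring

end DirichletCharacter

lemma Complex.im_neg_log_one_sub_exp {x : ℝ} (h0 : 0 < x) (h1 : x < 1) :
    (-Complex.log (1 - Complex.exp (2 * Real.pi * Complex.I * x))).im = Real.pi * (1 / 2 - x) := by
  have hs : 0 < 2 * Real.sin (Real.pi * x) := by
    have := Real.sin_pos_of_pos_of_lt_pi (x := Real.pi * x) (by positivity)
      (by nlinarith [Real.pi_pos])
    positivity
  have he : 1 - Complex.exp (2 * Real.pi * Complex.I * x) =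
      ((2 * Real.sin (Real.pi * x) : ℝ) : ℂ) *
        (Complex.cos ((Real.pi * (x - 1 / 2) : ℝ) : ℂ) +
          Complex.sin ((Real.pi * (x - 1 / 2) : ℝ) : ℂ) * Complex.I) := by
    have e1 : Real.pi * (x - 1 / 2) = Real.pi * x - Real.pi / 2 := by ring
    rw [← Complex.ofReal_cos, ← Complex.ofReal_sin, e1, Real.cos_sub_pi_div_two,
      Real.sin_sub_pi_div_two,
      show 2 * Real.pi * Complex.I * x = ((2 * (Real.pi * x) : ℝ) : ℂ) * Complex.I by
        push_cast; ring,
      Complex.exp_mul_I, ← Complex.ofReal_cos, ← Complex.ofReal_sin, Real.cos_two_mul,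
      Real.sin_two_mul]
    have hsc : (Real.sin (Real.pi * x) : ℂ) ^ 2 + (Real.cos (Real.pi * x) : ℂ) ^ 2 = 1 := by
      exact_mod_cast Real.sin_sq_add_cos_sq (Real.pi * x)
    generalize Real.sin (Real.pi * x) = a at hsc
    generalize Real.cos (Real.pi * x) = b at hsc
    push_cast
    linear_combination -2 * hsc
  rw [Complex.neg_im, Complex.log_im, he, Complex.arg_mul_cos_add_sin_mul_I hs]
  · ring
  · constructor <;> nlinarith [Real.pi_pos]

/-- The Gaussian binomial coefficients, defined by the `q`-Pascal rule. -/
def qChoose {R : Type*} [CommRing R] (q : R) : ℕ → ℕ → R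
  | _, 0 => 1
  | 0, _ + 1 => 0
  | m + 1, j + 1 => qChoose q m j + q ^ (j + 1) * qChoose q m (j + 1)

namespace qChoose

variable {R : Type*} [CommRing R] (q : R)

@[simp] lemma zero_right (m : ℕ) : qChoose q m 0 = 1 := by
  cases m <;> rfl

@[simp] lemma zero_succ (j : ℕ) : qChoose q 0 (j + 1) = 0 := rfl

lemma succ_succ (m j : ℕ) :
    qChoose q (m + 1) (j + 1) = qChoose q m j + q ^ (j + 1) * qChoose q m (j + 1) := rfl

lemma eq_zero_of_lt {m j : ℕ} (h : m < j) : qChoose q m j = 0 := by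
  induction m generalizing j with
  | zero =>
    obtain ⟨j, rfl⟩ := Nat.exists_eq_succ_of_ne_zero h.ne'
    rfl
  | succ m ih =>
    obtain ⟨j, rfl⟩ := Nat.exists_eq_succ_of_ne_zero (Nat.ne_of_gt (by omega : 0 < j))
    rw [Nat.succ_eq_add_one, succ_succ, ih (by omega), ih (by omega)]
    simp

lemma one_sub_pow_mul_succ (m j : ℕ) :
    (1 - q ^ (j + 1)) * qChoose q (m + 1) (j + 1) = (1 - q ^ (m + 1)) * qChoose q m j := by
  induction m generalizing j with
  | zero =>
    cases j with
    | zero => simp [succ_succ]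
    | succ j => simp [succ_succ]
  | succ m ih =>
    have h1 := ih j
    have h2 := succ_succ q (m + 1) j
    cases j with
    | zero =>
      simp only [zero_right] at *
      rw [h2]
      linear_combination q * h1
    | succ j =>
      have h3 := ih (j := j)
      have h4 := succ_succ q m j
      rw [h2]
      linear_combination q ^ (j + 2) * h1 + q * h3 - q * (1 - q ^ (m + 1)) * h4

/-- Gauss's alternating sum of Gaussian binomial coefficients. -/
lemma sum_neg_one_pow_mul_succ_succ (m : ℕ) :
    ∑ j ∈ Finset.range (m + 3), (-1) ^ j * qChoose q (m + 2) j =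
      (1 - q ^ (m + 1)) * ∑ j ∈ Finset.range (m + 1), (-1) ^ j * qChoose q m j := by
  have h1 : ∑ j ∈ Finset.range (m + 3), (-1) ^ j * qChoose q (m + 2) j =
      ∑ j ∈ Finset.range (m + 2), (-1) ^ j * ((q ^ j - 1) * qChoose q (m + 1) j) := by
    rw [Finset.sum_range_succ', Finset.sum_congr rfl fun j _ ↦ by rw [succ_succ q (m + 1) j]]
    have h2 : ∑ j ∈ Finset.range (m + 2), (-1) ^ j * (q ^ j * qChoose q (m + 1) j) =
        ∑ j ∈ Finset.range (m + 2), (-1) ^ (j + 1) * (q ^ (j + 1) * qChoose q (m + 1) (j + 1)) +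
          1 := by
      have h3 := Finset.sum_range_succ' (fun j ↦ (-1) ^ j * (q ^ j * qChoose q (m + 1) j)) (m + 2)
      rw [Finset.sum_range_succ, eq_zero_of_lt q (by omega : m + 1 < m + 2)] at h3
      simpa using h3
    simp only [mul_add, sub_mul, mul_sub, Finset.sum_add_distrib, Finset.sum_sub_distrib, h2,
      pow_succ (-1 : R), mul_neg_one, neg_mul, Finset.sum_neg_distrib, one_mul]
    simp
    ring
  rw [h1, Finset.sum_range_succ', Finset.mul_sum]
  simp only [pow_zero, sub_self, zero_mul, mul_zero, add_zero]
  refine Finset.sum_congr rfl fun j _ ↦ ?_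
  linear_combination (-1) ^ j * one_sub_pow_mul_succ q m j

lemma sum_neg_one_pow_mul_two_mul (n : ℕ) :
    ∑ j ∈ Finset.range (2 * n + 1), (-1) ^ j * qChoose q (2 * n) j =
      ∏ k ∈ Finset.range n, (1 - q ^ (2 * k + 1)) := by
  induction n with
  | zero => simp
  | succ n ih =>
    rw [Finset.prod_range_succ, ← ih, mul_comm (Finset.sum _ _), ← sum_neg_one_pow_mul_succ_succ]
    rfl

lemma eq_of_pow_eq_one [IsDomain R] {q : R} {p : ℕ} (hq : q ^ (p + 1) = 1)
    (hq1 : ∀ j, 0 < j → j ≤ p → q ^ j ≠ 1) {j : ℕ} (hj : j ≤ p) :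
    q ^ (j * (j + 1) / 2) * ((-1) ^ j * qChoose q p j) = 1 := by
  induction j with
  | zero => simp
  | succ j ih =>
    have h0 : qChoose q (p + 1) (j + 1) = 0 := by
      have h := one_sub_pow_mul_succ q p j
      rw [hq, sub_self, zero_mul] at h
      exact (mul_eq_zero.mp h).resolve_left
        (sub_ne_zero.mpr (hq1 (j + 1) (by omega) hj).symm)
    have h1 : (j + 1) * (j + 1 + 1) / 2 = j * (j + 1) / 2 + (j + 1) := by
      rw [show (j + 1) * (j + 1 + 1) = j * (j + 1) + (j + 1) * 2 by ring,
        Nat.add_mul_div_right _ _ two_pos]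
    rw [succ_succ] at h0
    rw [h1, pow_add, pow_succ (-1 : R)]
    refine Eq.trans ?_ (ih (by omega))
    linear_combination (-(q ^ (j * (j + 1) / 2) * (-1) ^ j)) * h0

end qChoose

lemma ZMod.natCast_val_eq_finEquiv {N : ℕ} [NeZero N] (i : Fin N) :
    ((i : ℕ) : ZMod N) = ZMod.finEquiv N i := by
  obtain ⟨m, rfl⟩ := Nat.exists_eq_succ_of_ne_zero (NeZero.ne N)
  exact Fin.cast_val_eq_self i

open ZMod in
/-- The product formula for the quadratic exponential sum at a prime modulus. -/
lemma sum_stdAddChar_sq_eq_prod_zpow {p m : ℕ} [Fact p.Prime] (hp : p = 2 * m + 1) :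
    ∑ a : ZMod p, stdAddChar (a ^ 2) =
      ∏ k ∈ Finset.range m, ((stdAddChar (1 : ZMod p)) ^ (2 * k + 1) -
        ((stdAddChar (1 : ZMod p)) ^ (2 * k + 1))⁻¹) := by
  set ζ : ℂ := stdAddChar (1 : ZMod p) with hζ
  have hcast (n : ℕ) : stdAddChar (n : ZMod p) = ζ ^ n := by
    rw [hζ, ← AddChar.map_nsmul_eq_pow, nsmul_eq_mul, mul_one]
  have hζp : ζ ^ p = 1 := by rw [← hcast, ZMod.natCast_self, AddChar.map_zero_eq_one]
  have hζ0 : ζ ≠ 0 := by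
    intro h
    rw [h, zero_pow (NeZero.ne p)] at hζp
    exact zero_ne_one hζp
  have hζ1 (n : ℕ) (h : ζ ^ n = 1) : p ∣ n := by
    rw [← ZMod.natCast_eq_zero_iff]
    refine ZMod.injective_stdAddChar ?_
    rw [hcast, h, AddChar.map_zero_eq_one]
  have hcop : Nat.Coprime p 2 := by
    rw [hp]
    simp
  have hsum : ∑ a : ZMod p, stdAddChar (a * (a + 1)) =
      ∏ k ∈ Finset.range m, (1 - ((ζ ^ 2)⁻¹) ^ (2 * k + 1)) := by
    rw [← qChoose.sum_neg_one_pow_mul_two_mul, ← hp, Finset.sum_range]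
    refine (Fintype.sum_equiv (ZMod.finEquiv p).toEquiv _ _ fun j ↦ ?_).symm
    have hj : ((ZMod.finEquiv p).toEquiv j : ZMod p) = ((j : ℕ) : ZMod p) := by
      exact (ZMod.natCast_val_eq_finEquiv j).symm
    have hc : ((j : ℕ) : ZMod p) * ((j : ℕ) + 1) = (((j : ℕ) * (j + 1) : ℕ) : ZMod p) := by
      push_cast
      rfl
    rw [hj, hc, hcast]
    have h := qChoose.eq_of_pow_eq_one (q := (ζ ^ 2)⁻¹) (p := 2 * m) (j := j)
      (by rw [← hp, inv_pow, ← pow_mul, mul_comm, pow_mul, hζp, one_pow, inv_one])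
      (fun i hi hi' h ↦ by
        rw [inv_pow, inv_eq_one, ← pow_mul] at h
        have := Nat.le_of_dvd hi (hcop.dvd_of_dvd_mul_left (hζ1 _ h))
        omega) (by have := j.2; omega)
    rw [inv_pow, ← pow_mul, Nat.mul_div_cancel' (Nat.even_mul_succ_self _).two_dvd,
      inv_mul_eq_one₀ (pow_ne_zero _ hζ0)] at h
    exact h.symm
  have hshift : ∑ a : ZMod p, stdAddChar (a ^ 2) =
      ζ ^ (m + 1) ^ 2 * ∑ a : ZMod p, stdAddChar (a * (a + 1)) := by
    rw [← Equiv.sum_comp (Equiv.addRight ((m + 1 : ℕ) : ZMod p)), Finset.mul_sum]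
    refine Finset.sum_congr rfl fun a _ ↦ ?_
    rw [← hcast, ← AddChar.map_add_eq_mul]
    congr 1
    have h2 : (2 * (m + 1 : ℕ) : ZMod p) = 1 := by
      have : ((2 * m + 1 : ℕ) : ZMod p) = 0 :=
        (ZMod.natCast_eq_zero_iff _ p).mpr ⟨1, by rw [mul_one, hp]⟩
      push_cast at this ⊢
      linear_combination this
    simp only [Equiv.coe_addRight]
    push_cast at h2 ⊢
    linear_combination a * h2
  have hodd : ∑ k ∈ Finset.range m, (2 * k + 1) = m ^ 2 := by
    rw [Finset.sum_add_distrib, ← Finset.mul_sum, mul_comm, Finset.sum_range_id_mul_two]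
    cases m <;> simp
    ring
  have hpow : ζ ^ (m + 1) ^ 2 = ∏ k ∈ Finset.range m, ζ ^ (2 * k + 1) := by
    rw [Finset.prod_pow_eq_pow_sum, hodd, show (m + 1) ^ 2 = m ^ 2 + p by rw [hp]; ring, pow_add,
      hζp, mul_one]
  rw [hshift, hsum, hpow, ← Finset.prod_mul_distrib]
  refine Finset.prod_congr rfl fun k _ ↦ ?_
  rw [inv_pow, pow_right_comm]
  have : ζ ^ (2 * k + 1) ≠ 0 := pow_ne_zero _ hζ0
  field_simp

open ZMod in
lemma sum_stdAddChar_sq_eq_prod_sin {p m : ℕ} [Fact p.Prime] (hp : p = 2 * m + 1) :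
    ∑ a : ZMod p, stdAddChar (a ^ 2) =
      ∏ k ∈ Finset.range m,
        (((2 * Real.sin (2 * Real.pi * (2 * k + 1) / p) : ℝ) : ℂ) * Complex.I) := by
  rw [sum_stdAddChar_sq_eq_prod_zpow hp]
  refine Finset.prod_congr rfl fun k _ ↦ ?_
  have h := ZMod.stdAddChar_coe (N := p) 1
  rw [Int.cast_one] at h
  rw [h, ← Complex.exp_nat_mul, ← Complex.exp_neg,
    show ((2 * k + 1 : ℕ) : ℂ) * (2 * Real.pi * Complex.I * ((1 : ℤ) : ℂ) / p) =
      ((2 * Real.pi * (2 * k + 1) / p : ℝ) : ℂ) * Complex.I by push_cast; ring]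
  generalize 2 * Real.pi * (2 * k + 1) / p = x
  rw [← neg_mul, Complex.exp_mul_I, Complex.exp_mul_I, Complex.cos_neg, Complex.sin_neg]
  push_cast
  ring

lemma prod_mul_I_mul_I_pos {n : ℕ} {f g : ℕ → ℝ} (hf : ∀ k < n, 0 < f k) (hg : ∀ k < n, g k < 0) :
    ∃ r : ℝ, 0 < r ∧ (∏ k ∈ Finset.range n, (f k * Complex.I)) *
      ∏ k ∈ Finset.range n, (g k * Complex.I) = r := by
  refine ⟨∏ k ∈ Finset.range n, -(f k * g k), Finset.prod_pos fun k hk ↦ ?_, ?_⟩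
  · rw [Finset.mem_range] at hk
    nlinarith [hf k hk, hg k hk]
  · rw [← Finset.prod_mul_distrib]
    push_cast
    refine Finset.prod_congr rfl fun k _ ↦ ?_
    linear_combination (f k * g k : ℂ) * Complex.I_sq

lemma sin_two_pi_mul_div_pos {p k : ℕ} (h : 2 * (2 * k + 1) < p) :
    0 < 2 * Real.sin (2 * Real.pi * (2 * k + 1) / p) := by
  have hp : (0 : ℝ) < p := by exact_mod_cast (by omega : 0 < p)
  have h' : (2 * (2 * k + 1) : ℝ) < p := by exact_mod_cast h
  refine mul_pos two_pos (Real.sin_pos_of_pos_of_lt_pi (by positivity) ?_)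
  rw [div_lt_iff₀ hp]
  nlinarith [Real.pi_pos]

lemma sin_two_pi_mul_div_neg {p k : ℕ} (h : p < 2 * (2 * k + 1)) (h1 : 2 * k + 1 < p) :
    2 * Real.sin (2 * Real.pi * (2 * k + 1) / p) < 0 := by
  have hp : (0 : ℝ) < p := by exact_mod_cast (by omega : 0 < p)
  have h' : (p : ℝ) < 2 * (2 * k + 1) := by exact_mod_cast h
  have h1' : (2 * k + 1 : ℝ) < p := by exact_mod_cast h1
  have : 0 < Real.sin (2 * Real.pi * (2 * k + 1) / p - Real.pi) := by
    refine Real.sin_pos_of_pos_of_lt_pi ?_ ?_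
    · rw [sub_pos, lt_div_iff₀ hp]
      nlinarith [Real.pi_pos]
    · rw [sub_lt_iff_lt_add, div_lt_iff₀ hp]
      nlinarith [Real.pi_pos]
  rw [Real.sin_sub_pi] at this
  linarith

/-- The complex-valued Legendre symbol as a Dirichlet character. -/
noncomputable def legendreChar (p : ℕ) [Fact p.Prime] : DirichletCharacter ℂ p :=
  (quadraticChar (ZMod p)).ringHomComp (Int.castRingHom ℂ)

section

variable {p : ℕ} [Fact p.Prime]

lemma legendreChar_apply (a : ZMod p) : legendreChar p a = (quadraticChar (ZMod p) a : ℂ) := rfl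

lemma legendreChar_isQuadratic : (legendreChar p).IsQuadratic :=
  (quadraticChar_isQuadratic _).comp _

lemma legendreChar_ne_one (hp : p ≠ 2) : legendreChar p ≠ 1 :=
  (MulChar.ringHomComp_ne_one_iff (Int.castRingHom ℂ).injective_int).mpr
    (quadraticChar_ne_one (by rwa [ZMod.ringChar_zmod_n]))

lemma gaussSum_legendreChar_eq (hp : p ≠ 2) :
    gaussSum (legendreChar p) ZMod.stdAddChar = ∑ a : ZMod p, ZMod.stdAddChar (a ^ 2) := by
  classical
  have hp' : ringChar (ZMod p) ≠ 2 := by rwa [ZMod.ringChar_zmod_n]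
  have h0 : (ZMod.stdAddChar : AddChar (ZMod p) ℂ) ≠ 1 := by
    rw [← AddChar.mulShift_one ZMod.stdAddChar]
    exact ZMod.isPrimitive_stdAddChar p one_ne_zero
  have h1 : ∑ a : ZMod p, ZMod.stdAddChar a = (0 : ℂ) := AddChar.sum_eq_zero_of_ne_one h0
  rw [← Finset.sum_fiberwise _ (fun a : ZMod p ↦ a ^ 2), gaussSum, ← add_zero (Finset.sum _ _),
    ← h1, ← Finset.sum_add_distrib]
  refine Finset.sum_congr rfl fun b _ ↦ ?_
  rw [Finset.sum_congr rfl (g := fun _ ↦ ZMod.stdAddChar b)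
    (fun a ha ↦ by rw [(Finset.mem_filter.mp ha).2]), Finset.sum_const, nsmul_eq_mul]
  have h2 := quadraticChar_card_sqrts hp' b
  have h3 : {x : ZMod p | x ^ 2 = b}.toFinset = Finset.univ.filter fun a ↦ a ^ 2 = b := by
    ext
    simp
  rw [h3] at h2
  rw [legendreChar_apply, ← add_one_mul]
  congr 1
  exact_mod_cast h2.symm

lemma gaussSum_legendreChar_sq (hp : p ≠ 2) :
    gaussSum (legendreChar p) ZMod.stdAddChar ^ 2 = (ZMod.χ₄ p : ℂ) * p := by
  have hp' : ringChar (ZMod p) ≠ 2 := by rwa [ZMod.ringChar_zmod_n]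
  have h := gaussSum_sq (χ := legendreChar p) (legendreChar_ne_one hp) legendreChar_isQuadratic
    (ZMod.isPrimitive_stdAddChar p)
  rwa [legendreChar_apply, quadraticChar_neg_one hp', ZMod.card] at h

/-- The sign of the quadratic Gauss sum, for `p ≡ 1 mod 4`. -/
theorem gaussSum_legendreChar_of_mod_four_eq_one (hp : p % 4 = 1) :
    gaussSum (legendreChar p) ZMod.stdAddChar = (√p : ℝ) := by
  have hp2 : p ≠ 2 := by omega
  obtain ⟨n, hn⟩ : ∃ n, p = 2 * (n + n) + 1 := ⟨p / 4, by omega⟩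
  have h := gaussSum_legendreChar_sq hp2
  rw [ZMod.χ₄_nat_one_mod_four hp] at h
  rw [gaussSum_legendreChar_eq hp2, sum_stdAddChar_sq_eq_prod_sin hn,
    Finset.prod_range_add] at h ⊢
  obtain ⟨r, hr, e⟩ := prod_mul_I_mul_I_pos (n := n)
    (f := fun k ↦ 2 * Real.sin (2 * Real.pi * (2 * k + 1) / p))
    (g := fun k ↦ 2 * Real.sin (2 * Real.pi * (2 * (n + k : ℕ) + 1) / p))
    (fun k hk ↦ sin_two_pi_mul_div_pos (by omega))
    (fun k hk ↦ sin_two_pi_mul_div_neg (by omega) (by omega))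
  rw [e] at h ⊢
  rw [← Real.sqrt_sq hr.le]
  congr 2
  norm_cast at h
  simpa using h

/-- The sign of the quadratic Gauss sum, for `p ≡ 3 mod 4`. -/
theorem gaussSum_legendreChar_of_mod_four_eq_three (hp : p % 4 = 3) :
    gaussSum (legendreChar p) ZMod.stdAddChar = (√p : ℝ) * Complex.I := by
  have hp2 : p ≠ 2 := by omega
  obtain ⟨n, hn⟩ : ∃ n, p = 2 * (n + 1 + n) + 1 := ⟨p / 4, by omega⟩
  have h := gaussSum_legendreChar_sq hp2
  rw [ZMod.χ₄_nat_three_mod_four hp] at h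
  rw [gaussSum_legendreChar_eq hp2, sum_stdAddChar_sq_eq_prod_sin hn,
    Finset.prod_range_add, Finset.prod_range_succ, mul_right_comm] at h ⊢
  obtain ⟨r, hr, e⟩ := prod_mul_I_mul_I_pos (n := n)
    (f := fun k ↦ 2 * Real.sin (2 * Real.pi * (2 * k + 1) / p))
    (g := fun k ↦ 2 * Real.sin (2 * Real.pi * (2 * (n + 1 + k : ℕ) + 1) / p))
    (fun k hk ↦ sin_two_pi_mul_div_pos (by omega))
    (fun k hk ↦ sin_two_pi_mul_div_neg (by omega) (by omega))
  have hs := sin_two_pi_mul_div_pos (p := p) (k := n) (by omega)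
  rw [e] at h ⊢
  generalize 2 * Real.sin (2 * Real.pi * (2 * n + 1) / p) = s at *
  have h2 : (r * s) ^ 2 = (p : ℝ) := by
    have : ((r * s : ℝ) : ℂ) ^ 2 = (p : ℝ) := by
      push_cast at h ⊢
      linear_combination -h + (r * s : ℂ) ^ 2 * Complex.I_sq
    exact_mod_cast this
  rw [← h2, Real.sqrt_sq (by positivity)]
  push_cast
  ring

end

/-- The sum of the Legendre symbols modulo `p` over the integers in `[0, p / 3)`. -/
def legendreThirdSum (p : ℕ) [Fact p.Prime] : ℤ :=
  ∑ a : ZMod p, if 3 * a.val < p then quadraticChar (ZMod p) a else 0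

section

variable {p : ℕ} [Fact p.Prime]

lemma sum_upper_third_quadraticChar :
    (∑ a : ZMod p, if 2 * p < 3 * a.val then quadraticChar (ZMod p) a else 0) =
      quadraticChar (ZMod p) (-1) * legendreThirdSum p := by
  rw [legendreThirdSum, Finset.mul_sum, ← Equiv.sum_comp (Equiv.neg (ZMod p))]
  refine Finset.sum_congr rfl fun a _ ↦ ?_
  rw [Equiv.neg_apply, ZMod.neg_val]
  by_cases ha : a = 0
  · simp [ha]
  have := a.val_lt
  rw [if_neg ha, ← neg_one_mul a, map_mul]
  split_ifs <;> first | rfl | omega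

lemma sum_quadraticChar_mul_thirds (hp : p ≠ 2) :
    ∑ a : ZMod p, quadraticChar (ZMod p) a *
        (1 - (if 3 * a.val < p then 1 else 0) + if 2 * p < 3 * a.val then 1 else 0) =
      (quadraticChar (ZMod p) (-1) - 1) * legendreThirdSum p := by
  have h0 : ∑ a, quadraticChar (ZMod p) a = 0 :=
    quadraticChar_sum_zero (by rwa [ZMod.ringChar_zmod_n])
  rw [sub_mul, ← sum_upper_third_quadraticChar, one_mul, legendreThirdSum, ← zero_add (_ - _),
    show (0 : ℤ) + _ = ∑ a, quadraticChar (ZMod p) a + _ from congrArg (· + _) h0.symm,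
    ← Finset.sum_sub_distrib, ← Finset.sum_add_distrib]
  refine Finset.sum_congr rfl fun a _ ↦ ?_
  split_ifs <;> ring

lemma sum_quadraticChar_mul_val (hp : p ≠ 2) (hp3 : p ≠ 3) (h3 : quadraticChar (ZMod p) 3 = 1)
    (hodd : quadraticChar (ZMod p) (-1) = -1) :
    ∑ a : ZMod p, quadraticChar (ZMod p) a * (a.val : ℤ) = -(p * legendreThirdSum p) := by
  have hpp : p.Prime := Fact.out
  have h30 : (3 : ZMod p) ≠ 0 := by
    intro h
    rw [h, MulChar.map_zero] at h3
    exact zero_ne_one h3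
  have h1 : ∑ a : ZMod p, quadraticChar (ZMod p) a * (a.val : ℤ) =
      3 * (∑ a : ZMod p, quadraticChar (ZMod p) a * (a.val : ℤ)) -
        p * ∑ a : ZMod p, quadraticChar (ZMod p) a *
        (1 - (if 3 * a.val < p then 1 else 0) + if 2 * p < 3 * a.val then 1 else 0) := by
    conv_lhs => rw [← Equiv.sum_comp (Equiv.mulLeft₀ 3 h30)]
    rw [Finset.mul_sum, Finset.mul_sum, ← Finset.sum_sub_distrib]
    refine Finset.sum_congr rfl fun a _ ↦ ?_
    rw [Equiv.mulLeft₀_apply, map_mul, h3, one_mul]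
    by_cases ha : a = 0
    · simp [ha]
    have hlt := a.val_lt
    have hpos : 0 < a.val := ZMod.val_pos.mpr ha
    have hne (k : ℕ) (hk : k = 1 ∨ k = 2) : 3 * a.val ≠ k * p := by
      intro h
      have : 3 ∣ k * p := ⟨_, h.symm⟩
      rcases (Nat.Prime.dvd_mul Nat.prime_three).mp this with h | h
      · rcases hk with rfl | rfl <;> omega
      · exact hp3 ((Nat.prime_dvd_prime_iff_eq Nat.prime_three hpp).mp h).symm
    have hne1 := hne 1 (by simp)
    have hne2 := hne 2 (by simp)
    have hval : ((3 * a).val : ℤ) = 3 * a.val -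
        p * (1 - (if 3 * a.val < p then 1 else 0) + if 2 * p < 3 * a.val then 1 else 0) := by
      have hm : (3 * a).val = (3 * a.val) % p := by
        rw [← ZMod.val_natCast, Nat.cast_mul, ZMod.natCast_zmod_val]
        rfl
      rw [hm]
      split_ifs with h h' h'
      · omega
      · rw [Nat.mod_eq_of_lt h]
        push_cast
        ring
      · rw [Nat.mod_eq_sub_mod (by omega), Nat.mod_eq_sub_mod (by omega),
          Nat.mod_eq_of_lt (by omega)]
        omega
      · rw [Nat.mod_eq_sub_mod (by omega), Nat.mod_eq_of_lt (by omega)]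
        omega
    rw [hval]
    ring
  rw [sum_quadraticChar_mul_thirds hp, hodd] at h1
  linarith

lemma legendreChar_mul_gaussSum (hp : p ≠ 2) (n : ℕ) :
    legendreChar p n * gaussSum (legendreChar p) ZMod.stdAddChar =
      ∑ a : ZMod p with a ≠ 0, legendreChar p a * ZMod.stdAddChar a ^ n := by
  rw [Finset.sum_filter_of_ne (p := fun a : ZMod p ↦ a ≠ 0)
    (fun a _ h h0 ↦ h (by rw [h0, MulChar.map_zero, zero_mul]))]
  have hpow (a : ZMod p) : (ZMod.stdAddChar a : ℂ) ^ n = ZMod.stdAddChar.mulShift (n : ZMod p) a := by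
    rw [AddChar.mulShift_apply, ← AddChar.map_nsmul_eq_pow, nsmul_eq_mul]
  simp_rw [hpow]
  change _ = gaussSum (legendreChar p) (ZMod.stdAddChar.mulShift (n : ZMod p))
  by_cases h0 : (n : ZMod p) = 0
  · rw [h0, MulChar.map_zero, zero_mul, AddChar.mulShift_zero, gaussSum_one_right
      (legendreChar_ne_one hp)]
  · have h := gaussSum_mulShift (legendreChar p) ZMod.stdAddChar (Units.mk0 _ h0)
    rw [Units.val_mk0] at h
    rw [← h, ← mul_assoc, ← sq, legendreChar_apply, ← Int.cast_pow, quadraticChar_sq_one h0,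
      Int.cast_one, one_mul]

lemma stdAddChar_eq_exp (a : ZMod p) :
    ZMod.stdAddChar a = Complex.exp (2 * Real.pi * Complex.I * ((a.val / p : ℝ) : ℂ)) := by
  rw [ZMod.stdAddChar_apply, ZMod.toCircle_apply]
  push_cast
  congr 1
  ring

lemma gaussSum_legendreChar_ne_zero (hp : p ≠ 2) :
    gaussSum (legendreChar p) ZMod.stdAddChar ≠ 0 := by
  have : p % 4 = 1 ∨ p % 4 = 3 := by
    have := (Fact.out : p.Prime).eq_two_or_odd
    omega
  have h0 : ((√p : ℝ) : ℂ) ≠ 0 := by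
    rw [Complex.ofReal_ne_zero, Real.sqrt_ne_zero']
    exact_mod_cast (Fact.out : p.Prime).pos
  rcases this with h | h
  · rwa [gaussSum_legendreChar_of_mod_four_eq_one h]
  · rw [gaussSum_legendreChar_of_mod_four_eq_three h]
    exact mul_ne_zero h0 Complex.I_ne_zero

lemma val_div_mem_Ioo {a : ZMod p} (ha : a ≠ 0) : 0 < (a.val / p : ℝ) ∧ (a.val / p : ℝ) < 1 := by
  have hp : (0 : ℝ) < p := by exact_mod_cast (Fact.out : p.Prime).pos
  have h1 : (0 : ℝ) < a.val := by exact_mod_cast ZMod.val_pos.mpr ha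
  have h2 : (a.val : ℝ) < p := by exact_mod_cast a.val_lt
  exact ⟨by positivity, (div_lt_one hp).mpr h2⟩

/-- The case `p ≡ 3 mod 4`: the sum over the first third is a multiple of `L(1, χ)`. -/
theorem legendreThirdSum_of_mod_four_eq_three (hp : p % 4 = 3) (hp3 : p ≠ 3)
    (h3 : quadraticChar (ZMod p) 3 = 1) :
    √p * (DirichletCharacter.LFunction (legendreChar p) 1).re =
      Real.pi * legendreThirdSum p := by
  have hp2 : p ≠ 2 := by omega
  have hp0 : (p : ℝ) ≠ 0 := by exact_mod_cast (Fact.out : p.Prime).ne_zero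
  have hχ := legendreChar_ne_one hp2
  have hτ := gaussSum_legendreChar_ne_zero hp2
  have hodd : quadraticChar (ZMod p) (-1) = -1 := by
    rw [quadraticChar_neg_one (by rwa [ZMod.ringChar_zmod_n]), ZMod.card,
      ZMod.χ₄_nat_three_mod_four hp]
  have hL := DirichletCharacter.LFunction_one_eq_sum_log hχ
    (Finset.univ.filter fun a : ZMod p ↦ a ≠ 0)
    (fun a ↦ legendreChar p a / gaussSum (legendreChar p) ZMod.stdAddChar) ZMod.stdAddChar
    (fun a _ ↦ AddChar.norm_apply _ _)
    (fun a ha h ↦ (Finset.mem_filter.mp ha).2 (ZMod.injective_stdAddChar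
      (h.trans (AddChar.map_zero_eq_one _).symm)))
    (fun n ↦ by
      simp_rw [div_mul_eq_mul_div]
      rw [← Finset.sum_div, ← legendreChar_mul_gaussSum hp2, mul_div_cancel_right₀ _ hτ])
  simp_rw [div_mul_eq_mul_div] at hL
  rw [← Finset.sum_div, eq_div_iff hτ, gaussSum_legendreChar_of_mod_four_eq_three hp] at hL
  have him := congrArg Complex.im hL
  rw [← mul_assoc, mul_comm _ ((√p : ℝ) : ℂ), Complex.mul_I_im, Complex.re_ofReal_mul,
    Complex.im_sum] at him
  rw [him]
  have hterm (a : ZMod p) (ha : a ∈ Finset.univ.filter fun a : ZMod p ↦ a ≠ 0) :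
      (legendreChar p a * -Complex.log (1 - ZMod.stdAddChar a)).im =
        quadraticChar (ZMod p) a * (Real.pi * (1 / 2 - a.val / p)) := by
    obtain ⟨h0, h1⟩ := val_div_mem_Ioo (Finset.mem_filter.mp ha).2
    rw [legendreChar_apply, ← Complex.ofReal_intCast, Complex.im_ofReal_mul, stdAddChar_eq_exp,
      Complex.im_neg_log_one_sub_exp h0 h1]
  have hs1 : ∑ a, (quadraticChar (ZMod p) a : ℝ) = 0 := by
    exact_mod_cast quadraticChar_sum_zero (F := ZMod p) (by rwa [ZMod.ringChar_zmod_n])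
  have hs2 : ∑ a : ZMod p, (quadraticChar (ZMod p) a : ℝ) * a.val = -(p * legendreThirdSum p) := by
    exact_mod_cast sum_quadraticChar_mul_val hp2 hp3 h3 hodd
  rw [Finset.sum_congr rfl hterm, Finset.sum_filter_of_ne (p := fun a : ZMod p ↦ a ≠ 0)
    (fun a _ h h0 ↦ h (by rw [h0, MulChar.map_zero, Int.cast_zero, zero_mul]))]
  calc ∑ a : ZMod p, (quadraticChar (ZMod p) a : ℝ) * (Real.pi * (1 / 2 - a.val / p))
      = Real.pi / 2 * ∑ a, (quadraticChar (ZMod p) a : ℝ) -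
        Real.pi / p * ∑ a : ZMod p, (quadraticChar (ZMod p) a : ℝ) * a.val := by
        rw [Finset.mul_sum, Finset.mul_sum, ← Finset.sum_sub_distrib]
        refine Finset.sum_congr rfl fun a _ ↦ ?_
        ring
    _ = Real.pi * legendreThirdSum p := by
        rw [hs1, hs2]
        field_simp
        ring

lemma Complex.im_neg_log_one_sub_exp_of_lt_two {x : ℝ} (h0 : 0 < x) (h1 : x ≠ 1) (h2 : x < 2) :
    (-Complex.log (1 - Complex.exp (2 * Real.pi * Complex.I * x))).im =
      Real.pi * (1 / 2 - x + if 1 < x then 1 else 0) := by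
  split_ifs with h
  · have hx : Complex.exp (2 * Real.pi * Complex.I * x) =
        Complex.exp (2 * Real.pi * Complex.I * (x - 1 : ℝ)) := by
      rw [← Complex.exp_periodic (2 * Real.pi * Complex.I * (x - 1 : ℝ))]
      congr 1
      push_cast
      ring
    rw [hx, Complex.im_neg_log_one_sub_exp (by linarith) (by linarith)]
    ring
  · rw [Complex.im_neg_log_one_sub_exp h0 (lt_of_le_of_ne (not_lt.mp h) h1), add_zero]

end

instance : Fact (Nat.Prime 3) := ⟨Nat.prime_three⟩

section

variable {p : ℕ} [Fact p.Prime]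

open DirichletCharacter

/-- The case `p ≡ 1 mod 4`: the sum over the first third is a multiple of `L(1, ψ)`, with `ψ` the
product of the Legendre symbols modulo `p` and modulo `3`. -/
theorem legendreThirdSum_of_mod_four_eq_one (hp : p % 4 = 1)
    (hψ : prodChar (legendreChar p) (legendreChar 3) ≠ 1) :
    √p * √3 * (LFunction (prodChar (legendreChar p) (legendreChar 3)) 1).re =
      2 * Real.pi * legendreThirdSum p := by
  have hpp : p.Prime := Fact.out
  have hp2 : p ≠ 2 := by omega
  have hp3 : p ≠ 3 := by omega
  have hp0 : (0 : ℝ) < p := by exact_mod_cast hpp.pos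
  have hτ := gaussSum_legendreChar_ne_zero hp2
  have hτ3 := gaussSum_legendreChar_ne_zero (p := 3) (by norm_num)
  have heven : quadraticChar (ZMod p) (-1) = 1 := by
    rw [quadraticChar_neg_one (by rwa [ZMod.ringChar_zmod_n]), ZMod.card,
      ZMod.χ₄_nat_one_mod_four hp]
  have hexp (j : ZMod p × ZMod 3) : ZMod.stdAddChar j.1 * ZMod.stdAddChar j.2 =
      Complex.exp (2 * Real.pi * Complex.I * ((j.1.val / p + j.2.val / 3 : ℝ) : ℂ)) := by
    rw [stdAddChar_eq_exp, stdAddChar_eq_exp, ← Complex.exp_add]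
    push_cast
    congr 1
    ring
  set T := (Finset.univ.filter fun a : ZMod p ↦ a ≠ 0) ×ˢ
    (Finset.univ.filter fun b : ZMod 3 ↦ b ≠ 0) with hT
  have hmem {j : ZMod p × ZMod 3} (hj : j ∈ T) : j.1 ≠ 0 ∧ j.2 ≠ 0 := by
    simpa [hT] using hj
  have hne {j : ZMod p × ZMod 3} (hj : j ∈ T) : (j.1.val / p + j.2.val / 3 : ℝ) ≠ 1 := by
    intro h
    have hpos : 0 < j.1.val := ZMod.val_pos.mpr (hmem hj).1
    have hlt := j.1.val_lt
    field_simp at h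
    have h' : j.1.val * 3 + p * j.2.val = p * 3 := by exact_mod_cast h
    have : p ∣ j.1.val * 3 := (Nat.dvd_add_left (dvd_mul_right p _)).mp (h' ▸ dvd_mul_right p 3)
    rcases hpp.dvd_mul.mp this with h | h
    · exact absurd (Nat.le_of_dvd hpos h) (by omega)
    · exact hp3 ((Nat.prime_dvd_prime_iff_eq hpp Nat.prime_three).mp h)
  have hbd {j : ZMod p × ZMod 3} (hj : j ∈ T) : 0 < (j.1.val / p + j.2.val / 3 : ℝ) ∧
      (j.1.val / p + j.2.val / 3 : ℝ) < 2 := by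
    obtain ⟨h1, h2⟩ := val_div_mem_Ioo (hmem hj).1
    obtain ⟨h3, h4⟩ := val_div_mem_Ioo (hmem hj).2
    push_cast at h3 h4
    constructor <;> linarith
  have hlog {j : ZMod p × ZMod 3} (hj : j ∈ T) :
      (-Complex.log (1 - ZMod.stdAddChar j.1 * ZMod.stdAddChar j.2)).im =
      Real.pi * (1 / 2 - (j.1.val / p + j.2.val / 3 : ℝ) +
        if 1 < (j.1.val / p + j.2.val / 3 : ℝ) then 1 else 0) := by
    rw [hexp, Complex.im_neg_log_one_sub_exp_of_lt_two (hbd hj).1 (hne hj) (hbd hj).2]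
  have hω {j : ZMod p × ZMod 3} (hj : j ∈ T) :
      (ZMod.stdAddChar j.1 * ZMod.stdAddChar j.2 : ℂ) ≠ 1 := by
    intro h
    rw [hexp, Complex.exp_eq_one_iff] at h
    obtain ⟨n, hn⟩ := h
    rw [mul_comm, mul_left_inj' Complex.two_pi_I_ne_zero] at hn
    have hn' : (j.1.val / p + j.2.val / 3 : ℝ) = n := by exact_mod_cast hn
    have h1 := hbd hj
    rw [hn'] at h1
    have h2 : 0 < n ∧ n < 2 := by exact_mod_cast h1
    exact hne hj (by rw [hn', show n = 1 by omega, Int.cast_one])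
  have hL := LFunction_one_eq_sum_log hψ T
    (fun j ↦ legendreChar p j.1 * legendreChar 3 j.2 / (gaussSum (legendreChar p) ZMod.stdAddChar *
      gaussSum (legendreChar 3) ZMod.stdAddChar)) (fun j ↦ ZMod.stdAddChar j.1 * ZMod.stdAddChar j.2)
    (fun j _ ↦ by rw [norm_mul, AddChar.norm_apply, AddChar.norm_apply, mul_one])
    (fun j hj ↦ hω hj)
    (fun n ↦ by
      simp_rw [div_mul_eq_mul_div]
      rw [← Finset.sum_div, eq_div_iff (mul_ne_zero hτ hτ3), prodChar_apply, mul_mul_mul_comm,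
        legendreChar_mul_gaussSum hp2, legendreChar_mul_gaussSum (by norm_num),
        Finset.sum_mul_sum, ← Finset.sum_product']
      refine Finset.sum_congr rfl fun j _ ↦ ?_
      rw [mul_pow]
      ring)
  simp_rw [div_mul_eq_mul_div] at hL
  rw [← Finset.sum_div, eq_div_iff (mul_ne_zero hτ hτ3),
    gaussSum_legendreChar_of_mod_four_eq_one hp,
    gaussSum_legendreChar_of_mod_four_eq_three (by norm_num)] at hL
  have him := congrArg Complex.im hL
  rw [show ∀ z : ℂ, z * (((√p : ℝ) : ℂ) * (((√(3 : ℕ) : ℝ) : ℂ) * Complex.I)) =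
    ((√p * √3 : ℝ) : ℂ) * z * Complex.I by intro z; push_cast; ring,
    Complex.mul_I_im, Complex.re_ofReal_mul, Complex.im_sum] at him
  rw [him]
  have hterm (j : ZMod p × ZMod 3) (hj : j ∈ T) :
      (legendreChar p j.1 * legendreChar 3 j.2 *
        -Complex.log (1 - ZMod.stdAddChar j.1 * ZMod.stdAddChar j.2)).im =
      quadraticChar (ZMod p) j.1 * (quadraticChar (ZMod 3) j.2 * (Real.pi *
        (1 / 2 - (j.1.val / p + j.2.val / 3 : ℝ) +
        if 1 < (j.1.val / p + j.2.val / 3 : ℝ) then 1 else 0))) := by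
    rw [legendreChar_apply, legendreChar_apply, mul_assoc, ← Complex.ofReal_intCast,
      Complex.im_ofReal_mul, ← Complex.ofReal_intCast, Complex.im_ofReal_mul, hlog hj]
  have hs1 : ∑ a, (quadraticChar (ZMod p) a : ℝ) = 0 := by
    exact_mod_cast quadraticChar_sum_zero (F := ZMod p) (by rwa [ZMod.ringChar_zmod_n])
  have hs2 : ∑ a : ZMod p, (if 3 * a.val < p then (quadraticChar (ZMod p) a : ℝ) else 0) =
      legendreThirdSum p := by
    exact_mod_cast rfl
  have hs3 : ∑ a : ZMod p, (if 2 * p < 3 * a.val then (quadraticChar (ZMod p) a : ℝ) else 0) =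
      legendreThirdSum p := by
    have := sum_upper_third_quadraticChar (p := p)
    rw [heven, one_mul] at this
    exact_mod_cast this
  have h3 : (Finset.univ.filter fun b : ZMod 3 ↦ b ≠ 0) = {1, 2} := by decide
  have hq1 : quadraticChar (ZMod 3) 1 = 1 := map_one _
  have hq2 : quadraticChar (ZMod 3) 2 = -1 := by decide
  have hv1 : (1 : ZMod 3).val = 1 := rfl
  have hv2 : (2 : ZMod 3).val = 2 := rfl
  rw [Finset.sum_congr rfl hterm, hT, Finset.sum_product]
  have hinner (a : ZMod p) (ha : a ∈ Finset.univ.filter fun a : ZMod p ↦ a ≠ 0) :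
      ∑ b : ZMod 3 with b ≠ 0, (quadraticChar (ZMod p) a : ℝ) * (quadraticChar (ZMod 3) b * (Real.pi *
        (1 / 2 - (a.val / p + b.val / 3 : ℝ) + if 1 < (a.val / p + b.val / 3 : ℝ) then 1 else 0))) =
      quadraticChar (ZMod p) a * (Real.pi * (-(2 / 3) + (if 3 * a.val < p then 1 else 0) +
        if 2 * p < 3 * a.val then 1 else 0)) := by
    have h1 : (1 < (a.val / p + (1 : ℕ) / 3 : ℝ)) ↔ 2 * p < 3 * a.val := by
      rw [← Nat.cast_lt (α := ℝ), div_add_div _ _ hp0.ne' three_ne_zero, lt_div_iff₀ (by positivity)]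
      push_cast
      constructor <;> intro <;> linarith
    have h2 : (1 < (a.val / p + (2 : ℕ) / 3 : ℝ)) ↔ ¬ 3 * a.val < p := by
      have hne := hne (j := (a, 2)) (by
        rw [hT, Finset.mem_product, h3]
        exact ⟨ha, Finset.mem_insert_of_mem (Finset.mem_singleton_self _)⟩)
      rw [hv2] at hne
      rw [← (not_lt.trans (Ne.le_iff_lt hne.symm)), not_iff_not, ← Nat.cast_lt (α := ℝ),
        div_add_div _ _ hp0.ne' three_ne_zero, div_lt_iff₀ (by positivity)]
      push_cast
      constructor <;> intro <;> linarith
    rw [h3, Finset.sum_pair (by decide), hq1, hq2, hv1, hv2]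
    simp only [h1, h2]
    split_ifs <;> push_cast <;> ring
  rw [Finset.sum_congr rfl hinner, Finset.sum_filter_of_ne (p := fun a : ZMod p ↦ a ≠ 0)
    (fun a _ h h0 ↦ h (by rw [h0, MulChar.map_zero, Int.cast_zero, zero_mul]))]
  calc _ = -(2 / 3) * Real.pi * ∑ a, (quadraticChar (ZMod p) a : ℝ) +
        Real.pi * (∑ a : ZMod p, if 3 * a.val < p then (quadraticChar (ZMod p) a : ℝ) else 0) +
        Real.pi * ∑ a : ZMod p, if 2 * p < 3 * a.val then (quadraticChar (ZMod p) a : ℝ) else 0 := by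
        simp_rw [Finset.mul_sum, ← Finset.sum_add_distrib]
        refine Finset.sum_congr rfl fun a _ ↦ ?_
        split_ifs <;> ring
    _ = 2 * Real.pi * legendreThirdSum p := by
        rw [hs1, hs2, hs3]
        ring

end

lemma MulChar.ne_one_of_apply_eq_neg_one {R : Type*} [CommMonoid R] {χ : MulChar R ℂ} {a : R}
    (h : χ a = -1) : χ ≠ 1 := by
  rintro rfl
  by_cases ha : IsUnit a
  · rw [MulChar.one_apply ha] at h
    norm_num at h
  · rw [MulChar.map_nonunit _ ha] at h
    norm_num at h

/-- A Legendre symbol can be made `-1` at an integer congruent to `1` modulo `m`. -/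
lemma exists_coprime_quadraticChar_eq_neg_one {p m M : ℕ} [Fact p.Prime] (hp : p ≠ 2)
    (hm : p.Coprime m) (hm0 : m ≠ 0) (hM : M ≠ 0) :
    ∃ n : ℕ, n.Coprime M ∧ quadraticChar (ZMod p) n = -1 ∧ n ≡ 1 [MOD m] := by
  have hpp : p.Prime := Fact.out
  obtain ⟨a, ha⟩ := quadraticChar_exists_neg_one (F := ZMod p) (by rwa [ZMod.ringChar_zmod_n])
  obtain ⟨k, hk, hk1⟩ := Nat.chineseRemainder hm a.val 1
  have hka : ((k : ℕ) : ZMod p) = a := by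
    rw [(ZMod.natCast_eq_natCast_iff _ _ _).mpr hk, ZMod.natCast_zmod_val]
  have hkp : k.Coprime p := by
    rw [← ZMod.isUnit_iff_coprime, hka, isUnit_iff_ne_zero]
    rintro rfl
    rw [MulChar.map_zero] at ha
    norm_num at ha
  have hkm : k.Coprime m := by
    rw [Nat.Coprime, hk1.gcd_eq, Nat.gcd_one_left]
  obtain ⟨n, hn, hnp, hnk⟩ := Nat.forall_exists_prime_gt_and_modEq M
    (mul_ne_zero hpp.ne_zero hm0) (hkp.mul_right hkm)
  refine ⟨n, (Nat.Prime.coprime_iff_not_dvd hnp).mpr fun h ↦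
    absurd (Nat.le_of_dvd (Nat.pos_of_ne_zero hM) h) (by omega), ?_, ?_⟩
  · rw [(ZMod.natCast_eq_natCast_iff _ _ _).mpr (hnk.of_mul_right m), hka, ha]
  · exact (hnk.of_mul_left p).trans hk1

namespace DirichletCharacter

/-- Siegel's lower bound for a family of quadratic characters which are pairwise not induced by
a common character. -/
theorem exists_forall_le_LFunction_one_of_pairwise {ι : Type*} {N : ι → ℕ} [∀ i, NeZero (N i)]
    (χ : ∀ i, DirichletCharacter ℂ (N i)) (h1 : ∀ i, χ i ≠ 1) (hq : ∀ i, (χ i).IsQuadratic)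
    (hsep : ∀ i j, i ≠ j → ∀ M ≠ 0, ∃ n : ℕ, n.Coprime M ∧ χ i n * χ j n = -1)
    {ε : ℝ} (hε : 0 < ε) :
    ∃ C > 0, ∀ i, C * (N i : ℝ) ^ (-ε) ≤ (LFunction (χ i) 1).re := by
  obtain ⟨N₁, hN₁, χ₁, C, hC, h⟩ := exists_char_forall_le_LFunction_one hε
  by_cases hex : ∃ i, prodChar χ₁ (χ i) = 1
  · obtain ⟨i, hi⟩ := hex
    have hL := re_LFunction_one_pos (h1 i) (hq i)
    have hNi : (0 : ℝ) < N i := by exact_mod_cast Nat.pos_of_ne_zero (NeZero.ne (N i))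
    have hpos : 0 < (LFunction (χ i) 1).re / (N i : ℝ) ^ (-ε) := by positivity
    refine ⟨min C ((LFunction (χ i) 1).re / (N i : ℝ) ^ (-ε)), lt_min hC hpos, fun j ↦ ?_⟩
    by_cases hij : i = j
    · subst hij
      rw [← le_div_iff₀ (by positivity)]
      exact min_le_right _ _
    · refine (mul_le_mul_of_nonneg_right (min_le_left _ _) (by positivity)).trans
        (h _ _ (h1 j) (hq j) fun hj ↦ ?_)
      obtain ⟨n, hn, e⟩ := hsep i j hij (N₁ * N i * N j)
        (mul_ne_zero (mul_ne_zero (NeZero.ne _) (NeZero.ne _)) (NeZero.ne _))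
      have hu (k : ι) (hk : prodChar χ₁ (χ k) = 1) (hc : n.Coprime (N₁ * N k)) :
          χ₁ n * χ k n = 1 := by
        rw [← prodChar_apply, hk, MulChar.one_apply ((ZMod.isUnit_iff_coprime _ _).mpr hc)]
      have e1 := hu i hi hn.coprime_mul_right_right
      have e2 := hu j hj (hn.coprime_dvd_right ⟨N i, by ring⟩)
      have e3 : χ₁ n ^ 2 = -1 := by
        linear_combination χ₁ n ^ 2 * e - χ₁ n * χ j n * e1 - e2
      have e4 : χ i n ^ 2 = -1 := by
        linear_combination χ i n ^ 2 * e3 - (χ₁ n * χ i n + 1) * e1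
      rcases hq i n with h | h | h <;> rw [h] at e4 <;> norm_num at e4
  · push Not at hex
    exact ⟨C, hC, fun i ↦ h _ _ (h1 i) (hq i) (hex i)⟩

end DirichletCharacter

lemma quadraticChar_natCast_eq_one_of_modEq {p m n : ℕ} [Fact p.Prime] (hpm : p ∣ m)
    (h : n ≡ 1 [MOD m]) : quadraticChar (ZMod p) n = 1 := by
  rw [(ZMod.natCast_eq_natCast_iff _ _ _).mpr (h.of_dvd hpm), Nat.cast_one, map_one]

lemma exists_forall_le_LFunction_legendreChar {ε : ℝ} (hε : 0 < ε) :
    ∃ C > 0, ∀ (p : ℕ) [Fact p.Prime], p ≠ 2 →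
      C * (p : ℝ) ^ (-ε) ≤ (DirichletCharacter.LFunction (legendreChar p) 1).re := by
  let ι := {p : ℕ // p.Prime ∧ p ≠ 2}
  have hι (i : ι) : Fact (i : ℕ).Prime := ⟨i.2.1⟩
  obtain ⟨C, hC, h⟩ := DirichletCharacter.exists_forall_le_LFunction_one_of_pairwise
    (fun i : ι ↦ legendreChar i) (fun i ↦ legendreChar_ne_one i.2.2)
    (fun i ↦ legendreChar_isQuadratic) (fun i j hij M hM ↦ by
      obtain ⟨n, hn, hi, hj⟩ := exists_coprime_quadraticChar_eq_neg_one (p := i) (m := j) i.2.2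
        ((Nat.coprime_primes i.2.1 j.2.1).mpr fun h ↦ hij (Subtype.ext h)) j.2.1.ne_zero hM
      refine ⟨n, hn, ?_⟩
      rw [legendreChar_apply, legendreChar_apply, hi,
        quadraticChar_natCast_eq_one_of_modEq dvd_rfl hj]
      norm_num) hε
  exact ⟨C, hC, fun p _ hp ↦ h ⟨p, Fact.out, hp⟩⟩

open DirichletCharacter in
lemma prodChar_legendreChar_three_ne_one {p : ℕ} [Fact p.Prime] (hp : p ≠ 2) (hp3 : p ≠ 3) :
    prodChar (legendreChar p) (legendreChar 3) ≠ 1 := by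
  obtain ⟨n, -, hn, h3⟩ := exists_coprime_quadraticChar_eq_neg_one (p := p) (m := 3) (M := 1) hp
    ((Nat.coprime_primes Fact.out Nat.prime_three).mpr hp3) three_ne_zero one_ne_zero
  refine MulChar.ne_one_of_apply_eq_neg_one (a := (n : ZMod (p * 3))) ?_
  rw [prodChar_apply, legendreChar_apply, legendreChar_apply, hn,
    quadraticChar_natCast_eq_one_of_modEq dvd_rfl h3]
  norm_num

open DirichletCharacter in
lemma exists_forall_le_LFunction_prodChar_legendreChar_three {ε : ℝ} (hε : 0 < ε) :
    ∃ C > 0, ∀ (p : ℕ) [Fact p.Prime], p ≠ 2 → p ≠ 3 →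
      C * ((p * 3 : ℕ) : ℝ) ^ (-ε) ≤
        (LFunction (prodChar (legendreChar p) (legendreChar 3)) 1).re := by
  let ι := {p : ℕ // p.Prime ∧ p ≠ 2 ∧ p ≠ 3}
  have hι (i : ι) : Fact (i : ℕ).Prime := ⟨i.2.1⟩
  obtain ⟨C, hC, h⟩ := exists_forall_le_LFunction_one_of_pairwise
    (fun i : ι ↦ prodChar (legendreChar i) (legendreChar 3))
    (fun i ↦ prodChar_legendreChar_three_ne_one i.2.2.1 i.2.2.2)
    (fun i ↦ prodChar_isQuadratic legendreChar_isQuadratic legendreChar_isQuadratic)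
    (fun i j hij M hM ↦ by
      obtain ⟨n, hn, hi, hj⟩ := exists_coprime_quadraticChar_eq_neg_one (p := i) (m := j * 3)
        (M := M * 3) i.2.2.1 (Nat.Coprime.mul_right
          ((Nat.coprime_primes i.2.1 j.2.1).mpr fun h ↦ hij (Subtype.ext h))
          ((Nat.coprime_primes i.2.1 Nat.prime_three).mpr i.2.2.2))
        (mul_ne_zero j.2.1.ne_zero three_ne_zero) (mul_ne_zero hM three_ne_zero)
      refine ⟨n, hn.coprime_mul_right_right, ?_⟩
      rw [prodChar_apply, prodChar_apply, legendreChar_apply, legendreChar_apply,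
        legendreChar_apply, hi, quadraticChar_natCast_eq_one_of_modEq (dvd_mul_right _ _) hj,
        quadraticChar_natCast_eq_one_of_modEq (dvd_mul_left _ _) hj]
      norm_num) hε
  exact ⟨C, hC, fun p _ hp hp3 ↦ h ⟨p, Fact.out, hp, hp3⟩⟩

lemma quadraticChar_three_of_mod_twelve {p : ℕ} [Fact p.Prime] (hp : p % 12 = 1 ∨ p % 12 = 11) :
    quadraticChar (ZMod p) 3 = 1 := by
  have h30 : (3 : ZMod p) ≠ 0 := by
    intro h
    have : p ∣ 3 := (ZMod.natCast_eq_zero_iff 3 p).mp h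
    have := Nat.le_of_dvd three_pos this
    have := (Fact.out : p.Prime).two_le
    omega
  rw [quadraticChar_one_iff_isSquare h30]
  rcases hp with hp | hp
  · have h := (ZMod.exists_sq_eq_prime_iff_of_mod_four_eq_one (p := p) (q := 3) (by omega)
      (by norm_num)).mpr
    rw [← ZMod.natCast_mod p 3, show p % 3 = 1 by omega, Nat.cast_one] at h
    exact h IsSquare.one
  · have h := (ZMod.exists_sq_eq_prime_iff_of_mod_four_eq_three (p := p) (q := 3) (by omega)
      (by norm_num) (by omega)).mpr
    rw [← ZMod.natCast_mod p 3, show p % 3 = 2 by omega] at h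
    exact h (by decide)

lemma legendreThirdSum_eq_sum_Icc {p : ℕ} [Fact p.Prime] (hp3 : p ≠ 3) :
    legendreThirdSum p = ∑ b ∈ Finset.Icc 1 (p / 3), quadraticChar (ZMod p) (b : ZMod p) := by
  have hpp : p.Prime := Fact.out
  have hnd : ¬ 3 ∣ p := fun h ↦ hp3 ((Nat.prime_dvd_prime_iff_eq Nat.prime_three hpp).mp h).symm
  rw [legendreThirdSum, ← Finset.sum_filter, ← Finset.sum_filter_of_ne (p := fun a : ZMod p ↦ a ≠ 0)
    (fun a _ h h0 ↦ h (by rw [h0, MulChar.map_zero])), Finset.filter_filter]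
  refine Finset.sum_nbij' ZMod.val (fun b ↦ (b : ZMod p)) ?_ ?_ ?_ ?_ ?_
  · intro a ha
    obtain ⟨h1, h2⟩ := (Finset.mem_filter.mp ha).2
    have := ZMod.val_pos.mpr h2
    rw [Finset.mem_Icc]
    omega
  · intro b hb
    rw [Finset.mem_Icc] at hb
    rw [Finset.mem_filter, ← ZMod.val_pos, ZMod.val_natCast_of_lt (by omega)]
    exact ⟨Finset.mem_univ _, by omega, by omega⟩
  · intro a _
    exact ZMod.natCast_zmod_val a
  · intro b hb
    rw [Finset.mem_Icc] at hb
    exact ZMod.val_natCast_of_lt (by omega)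
  · intro a _
    rw [ZMod.natCast_zmod_val]

lemma isQR_iff_isSquare (p a : ℕ) : IsQR p a ↔ IsSquare (a : ZMod p) := by
  rw [isSquare_iff_exists_sq]
  constructor
  · rintro ⟨x, hx⟩
    have := (ZMod.intCast_eq_intCast_iff _ _ _).mpr hx
    push_cast at this
    exact ⟨x, this.symm⟩
  · rintro ⟨y, hy⟩
    obtain ⟨x, rfl⟩ := ZMod.intCast_surjective y
    refine ⟨x, (ZMod.intCast_eq_intCast_iff _ _ _).mp ?_⟩
    push_cast
    exact hy.symm

lemma two_mul_Qcount_three {p : ℕ} [Fact p.Prime] (hp : p % 12 = 1 ∨ p % 12 = 11) :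
    2 * (Qcount p 3 : ℤ) = (p / 3 : ℕ) + legendreThirdSum p := by
  classical
  have h3 := quadraticChar_three_of_mod_twelve hp
  have hQ : Qcount p 3 =
      ((Finset.Icc 1 (p / 3)).filter fun b : ℕ ↦ quadraticChar (ZMod p) b = 1).card := by
    symm
    have hq {b : ℕ} (hb : 1 ≤ b ∧ b ≤ p / 3) :
        IsQR p (3 * b) ↔ quadraticChar (ZMod p) b = 1 := by
      have h0 : ((3 * b : ℕ) : ZMod p) ≠ 0 := by
        rw [Ne, ZMod.natCast_eq_zero_iff]
        exact fun h ↦ absurd (Nat.le_of_dvd (by omega) h) (by omega)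
      rw [isQR_iff_isSquare, ← quadraticChar_one_iff_isSquare h0, Nat.cast_mul, map_mul,
        Nat.cast_ofNat, h3, one_mul]
    refine Finset.card_nbij' (fun b ↦ 3 * b) (fun a ↦ a / 3) ?_ ?_ ?_ ?_
    · intro b hb
      rw [Finset.mem_coe, Finset.mem_filter, Finset.mem_Icc] at hb ⊢
      beta_reduce
      exact ⟨by omega, dvd_mul_right _ _, (hq hb.1).mpr hb.2⟩
    · intro a ha
      rw [Finset.mem_coe, Finset.mem_filter, Finset.mem_Icc] at ha ⊢
      obtain ⟨ha1, ⟨b, rfl⟩, ha2⟩ := ha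
      have hb : 1 ≤ b ∧ b ≤ p / 3 := by omega
      beta_reduce
      rw [Nat.mul_div_cancel_left _ three_pos]
      exact ⟨hb, (hq hb).mp ha2⟩
    · intro b _
      exact Nat.mul_div_cancel_left _ three_pos
    · intro a ha
      exact Nat.mul_div_cancel' (Finset.mem_filter.mp ha).2.1
  have hc : ((p / 3 : ℕ) : ℤ) = ∑ b ∈ Finset.Icc 1 (p / 3), 1 := by simp
  rw [hQ, legendreThirdSum_eq_sum_Icc (by omega), hc, ← Finset.sum_add_distrib,
    Finset.card_filter, Nat.cast_sum, Finset.mul_sum]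
  refine Finset.sum_congr rfl fun b hb ↦ ?_
  rw [Finset.mem_Icc] at hb
  have h0 : (b : ZMod p) ≠ 0 := by
    rw [Ne, ZMod.natCast_eq_zero_iff]
    exact fun h ↦ absurd (Nat.le_of_dvd (by omega) h) (by omega)
  rcases quadraticChar_dichotomy h0 with h | h <;> simp [h]

theorem stmt6 (ε : ℝ) (hε0 : 0 < ε) (hε : ε < 1 / 2) :
    ∃ C : ℝ, 0 < C ∧ ∀ p : ℕ, p.Prime → (p % 12 = 1 ∨ p % 12 = 11) →
      (Qcount p 3 : ℝ) - ((p : ℝ) - 1) / 6 ≥ C * (p : ℝ) ^ ((1 : ℝ) / 2 - ε) := by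
  obtain ⟨C₁, hC₁, h₁⟩ := exists_forall_le_LFunction_prodChar_legendreChar_three hε0
  obtain ⟨C₃, hC₃, h₃⟩ := exists_forall_le_LFunction_legendreChar hε0
  have hπ := Real.pi_pos
  refine ⟨min (C₁ * (√3 * 3 ^ (-ε)) / (4 * Real.pi)) (C₃ / (3 * Real.pi)), by positivity,
    fun p hpp hp ↦ ?_⟩
  have : Fact p.Prime := ⟨hpp⟩
  have hp0 : (0 : ℝ) < p := by exact_mod_cast hpp.pos
  have hpow : (p : ℝ) ^ ((1 : ℝ) / 2 - ε) = √p * (p : ℝ) ^ (-ε) := by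
    rw [sub_eq_add_neg, Real.rpow_add hp0, Real.sqrt_eq_rpow]
  have hQ : 2 * (Qcount p 3 : ℝ) = (p / 3 : ℕ) + legendreThirdSum p := by
    have h := congrArg (Int.cast : ℤ → ℝ) (two_mul_Qcount_three hp)
    simpa only [Int.cast_mul, Int.cast_add, Int.cast_natCast, Int.cast_ofNat] using h
  have h3 := quadraticChar_three_of_mod_twelve hp
  have hsp : 0 < √(p : ℝ) := Real.sqrt_pos.mpr hp0
  rw [hpow, ge_iff_le]
  rcases hp with hp | hp
  · have hS := legendreThirdSum_of_mod_four_eq_one (p := p) (by omega)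
      (prodChar_legendreChar_three_ne_one (by omega) (by omega))
    have hL := h₁ p (by omega) (by omega)
    rw [Nat.cast_mul, Real.mul_rpow hp0.le (by positivity), Nat.cast_ofNat] at hL
    have hdiv : ((p / 3 : ℕ) : ℝ) = (p - 1) / 3 := by
      rw [eq_div_iff three_ne_zero, eq_sub_iff_add_eq]
      exact_mod_cast (by omega : p / 3 * 3 + 1 = p)
    refine (mul_le_mul_of_nonneg_right (min_le_left _ _) (by positivity)).trans ?_
    have h := mul_le_mul_of_nonneg_left hL (by positivity : 0 ≤ √(p : ℝ) * √3)
    rw [hS] at h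
    calc C₁ * (√3 * 3 ^ (-ε)) / (4 * Real.pi) * (√p * (p : ℝ) ^ (-ε))
        = √p * √3 * (C₁ * ((p : ℝ) ^ (-ε) * 3 ^ (-ε))) / (4 * Real.pi) := by ring
      _ ≤ 2 * Real.pi * legendreThirdSum p / (4 * Real.pi) := by gcongr
      _ = (Qcount p 3 : ℝ) - ((p : ℝ) - 1) / 6 := by
        field_simp
        linarith
  · have hS := legendreThirdSum_of_mod_four_eq_three (p := p) (by omega) (by omega) h3
    have hL := h₃ p (by omega)
    have hdiv : ((p / 3 : ℕ) : ℝ) = (p - 2) / 3 := by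
      rw [eq_div_iff three_ne_zero, eq_sub_iff_add_eq]
      exact_mod_cast (by omega : p / 3 * 3 + 2 = p)
    refine (mul_le_mul_of_nonneg_right (min_le_right _ _) (by positivity)).trans ?_
    have h := mul_le_mul_of_nonneg_left hL hsp.le
    rw [hS] at h
    have hpos : (0 : ℝ) < legendreThirdSum p := by
      refine pos_of_mul_pos_right (lt_of_lt_of_le ?_ h) hπ.le
      positivity
    have h1 : (1 : ℝ) ≤ legendreThirdSum p := by
      have : 0 < legendreThirdSum p := by exact_mod_cast hpos
      exact_mod_cast this
    calc C₃ / (3 * Real.pi) * (√p * (p : ℝ) ^ (-ε))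
        = √p * (C₃ * (p : ℝ) ^ (-ε)) / (3 * Real.pi) := by ring
      _ ≤ Real.pi * legendreThirdSum p / (3 * Real.pi) := by gcongr
      _ = (legendreThirdSum p : ℝ) / 3 := by field_simp
      _ ≤ (Qcount p 3 : ℝ) - ((p : ℝ) - 1) / 6 := by linarith
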